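/- arXiv:0712.1903 — 3 statements merged into one kernel-verified Lean document; each statement's English description precedes it below -/
import Mathlib

section
/- Let B be a finite set of positive integers with b = max B, and let (c_j)_{j∈B} be positive reals. Write exp(∑_{j∈B} c_j w^j) = ∑_{n≥0} b_n w^n. If b_n > 0 for all sufficiently large n, then b_{n-1}/b_n ~ (n/(b·c_b))^{1/b} as n → ∞, i.e., the ratio (b_{n-1}/b_n) / (n/(b c_b))^{1/b} tends to 1. -/
open Filter

namespace Stmt9

lemma complex_ext (B : Finset ℕ) (c : ℕ → ℝ) (b : ℕ → ℝ)
    (hrep : ∀ w : ℝ, HasSum (fun n => b n * w ^ n) (Real.exp (∑ j ∈ B, c j * w ^ j))) (z : ℂ) :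
    HasSum (fun n => (b n : ℂ) * z ^ n) (Complex.exp (∑ j ∈ B, (c j : ℂ) * z ^ j)) := by
  have hs : ∀ z : ℂ, Summable (fun n => ‖(b n : ℂ) * z ^ n‖) := by
    intro z
    have := (hrep ‖z‖).summable.abs
    refine this.congr ?_
    intro n
    simp [abs_mul]
  set G : ℂ → ℂ := fun z => ∑' n, (b n : ℂ) * z ^ n with hG
  have hGd : Differentiable ℂ G := by
    intro z
    have h1 : DifferentiableOn ℂ G (Metric.ball 0 (‖z‖ + 1)) := by
      apply Complex.differentiableOn_tsum_of_summable_norm (hs ((‖z‖ + 1 : ℝ) : ℂ))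
      · intro i; fun_prop
      · exact Metric.isOpen_ball
      · intro i w hw
        have hw' : ‖w‖ < ‖z‖ + 1 := by simpa using hw
        have h2 : ‖((‖z‖ + 1 : ℝ) : ℂ)‖ = ‖z‖ + 1 := by
          rw [Complex.norm_real, Real.norm_of_nonneg (by positivity)]
        rw [norm_mul, norm_mul, norm_pow, norm_pow, h2]
        gcongr
    exact h1.differentiableAt (Metric.isOpen_ball.mem_nhds (by simp))
  have hFd : Differentiable ℂ (fun z : ℂ => Complex.exp (∑ j ∈ B, (c j : ℂ) * z ^ j)) := by
    fun_prop
  have hfreq : ∃ᶠ z in nhdsWithin (0 : ℂ) {0}ᶜ,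
      G z = Complex.exp (∑ j ∈ B, (c j : ℂ) * z ^ j) := by
    have ht : Tendsto (fun x : ℝ => (x : ℂ)) (nhdsWithin 0 {0}ᶜ) (nhdsWithin (0 : ℂ) {0}ᶜ) := by
      apply tendsto_nhdsWithin_iff.2
      constructor
      · have : Tendsto (fun x : ℝ => (x : ℂ)) (nhds 0) (nhds ((0 : ℝ) : ℂ)) :=
          Complex.continuous_ofReal.tendsto 0
        simpa using this.mono_left nhdsWithin_le_nhds
      · filter_upwards [self_mem_nhdsWithin] with x hx
        simpa using hx
    refine ht.frequently (Eventually.frequently (Eventually.of_forall ?_))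
    intro x
    have := (Complex.hasSum_ofReal.2 (hrep x)).tsum_eq
    push_cast at this
    exact this
  have := AnalyticOnNhd.eq_of_frequently_eq
    (fun x _ => hGd.analyticAt x) (fun x _ => hFd.analyticAt x) hfreq
  have h3 := congrFun this z
  rw [← h3]
  exact (hs z).of_norm.hasSum

lemma orth (m n : ℕ) : ∫ θ in (-Real.pi)..Real.pi,
    Complex.exp (m * θ * Complex.I) * Complex.exp (-(n * θ * Complex.I))
      = if m = n then 2 * (Real.pi : ℂ) else 0 := by
  split_ifs with h
  · subst h
    simp only [← Complex.exp_add, add_neg_cancel, Complex.exp_zero]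
    simp
    ring
  · have hne : (((m : ℂ) - n) * Complex.I) ≠ 0 := by
      refine mul_ne_zero (sub_ne_zero.2 ?_) Complex.I_ne_zero
      exact_mod_cast h
    have : ∀ θ : ℝ, Complex.exp (m * θ * Complex.I) * Complex.exp (-(n * θ * Complex.I))
        = Complex.exp ((((m : ℂ) - n) * Complex.I) * θ) := by
      intro θ
      rw [← Complex.exp_add]; congr 1; ring
    simp only [this]
    rw [integral_exp_mul_complex hne]
    have : Complex.exp ((((m : ℂ) - n) * Complex.I) * (Real.pi : ℝ))
       = Complex.exp ((((m : ℂ) - n) * Complex.I) * ((-Real.pi : ℝ) : ℝ)) := by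
      rw [Complex.exp_eq_exp_iff_exists_int]
      refine ⟨(m : ℤ) - n, ?_⟩
      push_cast
      ring
    rw [this, sub_self, zero_div]

lemma cauchy (a : ℕ → ℂ) (F : ℂ → ℂ) (h : ∀ z, HasSum (fun n => a n * z ^ n) (F z))
    (r : ℝ) (n : ℕ) :
    ∫ θ in (-Real.pi)..Real.pi, F (r * Complex.exp (θ * Complex.I))
        * Complex.exp (-(n * θ * Complex.I)) = 2 * Real.pi * (a n * r ^ n) := by
  have hsum : HasSum (fun m => ∫ θ in (-Real.pi)..Real.pi,
      a m * r ^ m * (Complex.exp (m * θ * Complex.I) * Complex.exp (-(n * θ * Complex.I))))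
      (∫ θ in (-Real.pi)..Real.pi, F (r * Complex.exp (θ * Complex.I))
        * Complex.exp (-(n * θ * Complex.I))) := by
    apply intervalIntegral.hasSum_integral_of_dominated_convergence
      (fun m _ => ‖a m * (r : ℂ) ^ m‖)
    · intro m
      apply Continuous.aestronglyMeasurable
      fun_prop
    · intro m
      refine Eventually.of_forall fun θ _ => ?_
      rw [norm_mul, norm_mul (Complex.exp _)]
      have e1 : ‖Complex.exp (m * θ * Complex.I)‖ = 1 := by
        have := Complex.norm_exp_ofReal_mul_I (m * θ)
        push_cast at this; exact this
      have e2 : ‖Complex.exp (-(n * θ * Complex.I))‖ = 1 := by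
        have := Complex.norm_exp_ofReal_mul_I (-(n * θ))
        push_cast at this; rw [← this]; congr 2; ring
      rw [e1, e2]; simp
    · exact Eventually.of_forall fun θ _ => (h r).summable.norm
    · exact intervalIntegrable_const
    · refine Eventually.of_forall fun θ _ => ?_
      have := (h (r * Complex.exp (θ * Complex.I))).mul_right (Complex.exp (-(n * θ * Complex.I)))
      refine this.congr_fun fun m => ?_
      rw [mul_pow, ← Complex.exp_nat_mul]
      ring_nf
  have h2 := hasSum_ite_eq n (2 * Real.pi * (a n * (r : ℂ) ^ n))
  refine hsum.unique (h2.congr_fun ?_)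
  intro m
  rw [intervalIntegral.integral_const_mul, orth]
  split_ifs with hm
  · subst hm; ring
  · simp

lemma pos_aux (B : Finset ℕ) (c : ℕ → ℝ) (hc : ∀ j ∈ B, 0 < c j) (b : ℕ → ℝ)
    (hrep : ∀ w : ℝ, HasSum (fun n => b n * w ^ n) (Real.exp (∑ j ∈ B, c j * w ^ j)))
    (hb : ∀ᶠ n in atTop, 0 < b n) (θ : ℝ) (h0 : θ ≠ 0) (hpi : |θ| ≤ Real.pi) :
    0 < ∑ j ∈ B, c j * (1 - Real.cos (j * θ)) := by
  have hnn : ∀ j ∈ B, 0 ≤ c j * (1 - Real.cos (j * θ)) := fun j hj =>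
    mul_nonneg (hc j hj).le (by linarith [Real.cos_le_one (j * θ)])
  refine lt_of_le_of_ne (Finset.sum_nonneg hnn) fun heq => ?_
  have hz := (Finset.sum_eq_zero_iff_of_nonneg hnn).1 heq.symm
  have hexp : ∀ j ∈ B, Complex.exp (θ * Complex.I) ^ j = 1 := by
    intro j hj
    have h1 : Real.cos (j * θ) = 1 := by
      rcases mul_eq_zero.1 (hz j hj) with h | h
      · exact absurd h (hc j hj).ne'
      · linarith
    obtain ⟨k, hk⟩ := (Real.cos_eq_one_iff _).1 h1
    rw [← Complex.exp_nat_mul, Complex.exp_eq_one_iff]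
    refine ⟨k, ?_⟩
    have : (k : ℂ) * (2 * Real.pi) = j * θ := by exact_mod_cast hk
    rw [← mul_assoc, ← this]; ring
  have hC := complex_ext B c b hrep
  have hC2 : ∀ z : ℂ, HasSum (fun n => ((b n : ℂ) * Complex.exp (θ * Complex.I) ^ n) * z ^ n)
      (Complex.exp (∑ j ∈ B, (c j : ℂ) * z ^ j)) := by
    intro z
    have := hC (Complex.exp (θ * Complex.I) * z)
    convert this using 2 with n
    · rw [mul_pow]; ring
    · refine Finset.sum_congr rfl fun j hj => ?_
      rw [mul_pow, hexp j hj, one_mul]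
  have hco : ∀ n, (b n : ℂ) * Complex.exp (θ * Complex.I) ^ n = b n := by
    intro n
    have h1 := cauchy _ _ hC 1 n
    have h2 := cauchy _ _ hC2 1 n
    rw [h1] at h2
    have hp : (2 * Real.pi : ℂ) ≠ 0 := by
      exact_mod_cast Real.two_pi_pos.ne'
    have := mul_left_cancel₀ hp h2
    simpa using this.symm
  obtain ⟨N, hN⟩ := eventually_atTop.1 hb
  have hz1 : ∀ n ≥ N, Complex.exp (θ * Complex.I) ^ n = 1 := by
    intro n hn
    have hne : (b n : ℂ) ≠ 0 := by exact_mod_cast (hN n hn).ne'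
    exact mul_left_cancel₀ hne (by rw [hco n, mul_one])
  have h1 : Complex.exp (θ * Complex.I) = 1 := by
    have a1 := hz1 N le_rfl
    have a2 := hz1 (N + 1) (by omega)
    rwa [pow_succ, a1, one_mul] at a2
  have h2 : Real.cos θ = 1 := by
    have := congrArg Complex.re h1
    rwa [Complex.exp_ofReal_mul_I_re, Complex.one_re] at this
  have := abs_le.1 hpi
  exact h0 ((Real.cos_eq_one_iff_of_lt_of_lt (by linarith [Real.pi_pos]) (by linarith [Real.pi_pos])).1 h2)

noncomputable def E (B : Finset ℕ) (c : ℕ → ℝ) (r θ : ℝ) : ℂ :=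
  ∑ j ∈ B, (c j : ℂ) * r ^ j * (Complex.exp (j * θ * Complex.I) - 1 - j * θ * Complex.I)

lemma E_re (B : Finset ℕ) (c : ℕ → ℝ) (r θ : ℝ) :
    (E B c r θ).re = - ∑ j ∈ B, c j * r ^ j * (1 - Real.cos (j * θ)) := by
  unfold E
  rw [Complex.re_sum, ← Finset.sum_neg_distrib]
  refine Finset.sum_congr rfl fun j _ => ?_
  have h1 : (Complex.exp (j * θ * Complex.I)).re = Real.cos (j * θ) := by
    have := Complex.exp_ofReal_mul_I_re (j * θ)
    push_cast at this; exact this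
  have h2 : ((j : ℂ) * θ * Complex.I).re = 0 := by simp
  have h3 : (c j : ℂ) * r ^ j = ((c j * r ^ j : ℝ) : ℂ) := by push_cast; rfl
  rw [h3, Complex.re_ofReal_mul, Complex.sub_re, Complex.sub_re, h1, h2]
  simp
  ring

lemma E_cont (B : Finset ℕ) (c : ℕ → ℝ) (r : ℝ) : Continuous (E B c r) := by
  unfold E
  fun_prop

lemma exists_delta (B : Finset ℕ) (c : ℕ → ℝ) (m : ℕ) (hm : 0 < m)
    (hpos : ∀ θ : ℝ, θ ≠ 0 → |θ| ≤ Real.pi → 0 < ∑ j ∈ B, c j * (1 - Real.cos (j * θ))) :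
    ∃ δ > 0, ∀ θ : ℝ, Real.pi / m ≤ |θ| → |θ| ≤ Real.pi →
      δ ≤ ∑ j ∈ B, c j * (1 - Real.cos (j * θ)) := by
  have hm' : (1 : ℝ) ≤ m := by exact_mod_cast hm
  have hle : Real.pi / m ≤ Real.pi := div_le_self Real.pi_pos.le hm'
  obtain ⟨x, hx, hmin⟩ := (isCompact_Icc (a := Real.pi / m) (b := Real.pi)).exists_isMinOn
    (f := fun θ : ℝ => ∑ j ∈ B, c j * (1 - Real.cos (j * θ))) ⟨Real.pi, hle, le_rfl⟩
    (by fun_prop)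
  have hx0 : 0 < x := lt_of_lt_of_le (by have := Real.pi_pos; positivity) hx.1
  refine ⟨_, hpos x hx0.ne' (by rw [abs_of_pos hx0]; exact hx.2), ?_⟩
  intro θ h1 h2
  have := hmin (show |θ| ∈ _ from ⟨h1, h2⟩)
  simp only [Set.mem_ofPred_eq] at this
  refine this.trans (le_of_eq (Finset.sum_congr rfl fun j _ => ?_))
  have : Real.cos (j * |θ|) = Real.cos (j * θ) := by
    rw [← Real.cos_abs (j * θ), abs_mul, Nat.abs_cast]
  rw [this]

lemma bound (B : Finset ℕ) (c : ℕ → ℝ) (hc : ∀ j ∈ B, 0 < c j) (m : ℕ) (hmB : m ∈ B) (hm : 0 < m)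
    (hBpos : ∀ j ∈ B, 0 < j) (δ : ℝ)
    (hδ : ∀ θ : ℝ, Real.pi / m ≤ |θ| → |θ| ≤ Real.pi →
      δ ≤ ∑ j ∈ B, c j * (1 - Real.cos (j * θ)))
    (r : ℝ) (hr : 1 ≤ r) (hr2 : Real.exp (-(δ * r)) * (1 + Real.pi ^ 2 * r ^ m) ≤ 1)
    (t : ℝ) (ht : |t| ≤ Real.pi * √(r ^ m)) :
    ‖Complex.exp (E B c r (t / √(r ^ m)))‖ ≤
      (1 + 1 / (2 * c m * m ^ 2 / Real.pi ^ 2)) * (1 + t ^ 2)⁻¹ := by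
  have hcm := hc m hmB
  have hpi := Real.pi_pos
  have hmR : (0 : ℝ) < m := by exact_mod_cast hm
  have hr0 : 0 < r := by linarith
  set s := √(r ^ m) with hs
  have hs0 : 0 < s := Real.sqrt_pos.2 (by positivity)
  have hs2 : s ^ 2 = r ^ m := Real.sq_sqrt (by positivity)
  set κ := 2 * c m * m ^ 2 / Real.pi ^ 2 with hκ
  have hκ0 : 0 < κ := by positivity
  have ht2 : 0 ≤ t ^ 2 := sq_nonneg t
  rw [Complex.norm_exp, E_re]
  have hnn : ∀ j ∈ B, 0 ≤ c j * r ^ j * (1 - Real.cos (j * (t / s))) := fun j hj =>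
    mul_nonneg (mul_nonneg (hc j hj).le (by positivity))
      (by linarith [Real.cos_le_one (j * (t / s))])
  rcases le_total (|t / s|) (Real.pi / m) with h | h
  · have h1 : κ * t ^ 2 ≤ ∑ j ∈ B, c j * r ^ j * (1 - Real.cos (j * (t / s))) := by
      refine le_trans ?_ (Finset.single_le_sum hnn hmB)
      have h2 : |(m : ℝ) * (t / s)| ≤ Real.pi := by
        rw [abs_mul, Nat.abs_cast]
        calc (m : ℝ) * |t / s| ≤ m * (Real.pi / m) := by gcongr
          _ = Real.pi := by field_simp
      have h3 := Real.cos_le_one_sub_mul_cos_sq h2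
      calc κ * t ^ 2 = c m * r ^ m * (2 / Real.pi ^ 2 * (m * (t / s)) ^ 2) := by
            rw [← hs2, hκ]; field_simp
        _ ≤ _ := by
            apply mul_le_mul_of_nonneg_left _ (by positivity)
            linarith
    have h4 : Real.exp (-∑ j ∈ B, c j * r ^ j * (1 - Real.cos (j * (t / s))))
        ≤ (1 + κ * t ^ 2)⁻¹ := by
      rw [Real.exp_neg]
      apply inv_anti₀ (by positivity)
      linarith [Real.add_one_le_exp (∑ j ∈ B, c j * r ^ j * (1 - Real.cos (j * (t / s))))]
    refine h4.trans ?_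
    rw [← div_eq_mul_inv, le_div_iff₀ (by positivity), inv_mul_le_iff₀ (by positivity)]
    have : (1 + κ * t ^ 2) * (1 + 1 / κ) = 1 + t ^ 2 + (κ * t ^ 2 + 1 / κ) := by
      field_simp; ring
    rw [this]
    have : 0 ≤ κ * t ^ 2 + 1 / κ := by positivity
    linarith
  · have hle : |t / s| ≤ Real.pi := by
      rw [abs_div, abs_of_pos hs0, div_le_iff₀ hs0]; exact ht
    have h1 := hδ _ h hle
    have h2 : δ * r ≤ ∑ j ∈ B, c j * r ^ j * (1 - Real.cos (j * (t / s))) := by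
      calc δ * r ≤ (∑ j ∈ B, c j * (1 - Real.cos (j * (t / s)))) * r := by gcongr
        _ ≤ _ := by
          rw [Finset.sum_mul]
          refine Finset.sum_le_sum fun j hj => ?_
          have h5 : r ≤ r ^ j := le_self_pow₀ hr (hBpos j hj).ne'
          have h6 : 0 ≤ c j * (1 - Real.cos (j * (t / s))) :=
            mul_nonneg (hc j hj).le (by linarith [Real.cos_le_one (j * (t / s))])
          nlinarith [mul_le_mul_of_nonneg_left h5 h6]
    have h3 : t ^ 2 ≤ Real.pi ^ 2 * r ^ m := by
      rw [← hs2, ← mul_pow, ← sq_abs t]; gcongr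
    calc Real.exp (-∑ j ∈ B, c j * r ^ j * (1 - Real.cos (j * (t / s))))
        ≤ Real.exp (-(δ * r)) := Real.exp_le_exp.2 (by linarith)
      _ ≤ (1 + t ^ 2)⁻¹ := by
          rw [← one_div, le_div_iff₀ (by positivity)]
          refine le_trans ?_ hr2
          gcongr
      _ ≤ _ := by
          apply le_mul_of_one_le_left (by positivity)
          have : 0 < 1 / κ := by positivity
          linarith

lemma s_tendsto (m : ℕ) (hm : 0 < m) : Tendsto (fun r : ℝ => √(r ^ m)) atTop atTop :=
  Real.tendsto_sqrt_atTop.comp (tendsto_pow_atTop hm.ne')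

lemma E_tendsto (B : Finset ℕ) (c : ℕ → ℝ) (m : ℕ) (hmB : m ∈ B) (hm : 0 < m)
    (hmax : ∀ j ∈ B, j ≤ m) (t : ℝ) :
    Tendsto (fun r : ℝ => E B c r (t / √(r ^ m))) atTop
      (nhds (((-(c m * m ^ 2 / 2) * t ^ 2 : ℝ) : ℂ))) := by
  have hsum : ((-(c m * m ^ 2 / 2) * t ^ 2 : ℝ) : ℂ) =
      ∑ j ∈ B, (if j = m then ((-(c m * m ^ 2 / 2) * t ^ 2 : ℝ) : ℂ) else 0) := by
    rw [Finset.sum_ite_eq' B m, if_pos hmB]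
  rw [hsum]
  unfold E
  refine tendsto_finsetSum _ fun j hj => ?_
  have hjm := hmax j hj
  -- main part
  have hratio : Tendsto (fun r : ℝ => r ^ j / r ^ m) atTop (nhds (if j = m then 1 else 0)) := by
    split_ifs with h
    · subst h
      refine tendsto_const_nhds.congr' ?_
      filter_upwards [eventually_gt_atTop 0] with r hr
      rw [div_self (by positivity)]
    · exact tendsto_pow_div_pow_atTop_zero (lt_of_le_of_ne hjm h)
  have hmain : Tendsto (fun r : ℝ => ((-(c j * j ^ 2 / 2) * t ^ 2 * (r ^ j / r ^ m) : ℝ) : ℂ)) atTop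
      (nhds (if j = m then ((-(c m * m ^ 2 / 2) * t ^ 2 : ℝ) : ℂ) else 0)) := by
    have := (Complex.continuous_ofReal.tendsto _).comp
      (hratio.const_mul (-(c j * j ^ 2 / 2) * t ^ 2))
    refine this.trans (le_of_eq ?_)
    split_ifs with h
    · subst h; simp
    · simp
  have hrem : Tendsto (fun r : ℝ => (c j : ℂ) * r ^ j * (Complex.exp (j * (t / √(r ^ m) : ℝ) * Complex.I) - 1
      - j * (t / √(r ^ m) : ℝ) * Complex.I)
      - ((-(c j * j ^ 2 / 2) * t ^ 2 * (r ^ j / r ^ m) : ℝ) : ℂ)) atTop (nhds 0) := by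
    apply squeeze_zero_norm' (a := fun r : ℝ => |c j| * |j * t| ^ 3 / √(r ^ m))
    · filter_upwards [eventually_ge_atTop 1, (s_tendsto m hm).eventually_ge_atTop (|j * t|),
        (s_tendsto m hm).eventually_gt_atTop 0] with r hr hx hs0
      have hs2 : √(r ^ m) ^ 2 = r ^ m := Real.sq_sqrt (by positivity)
      set s := √(r ^ m) with hs
      have hr0 : 0 < r := by linarith
      set z : ℂ := j * (t / s : ℝ) * Complex.I with hz
      have hzn : ‖z‖ = |j * t| / s := by
        rw [hz, norm_mul, norm_mul, Complex.norm_I, Complex.norm_real, Complex.norm_natCast,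
          Real.norm_eq_abs, abs_div, abs_of_pos hs0, abs_mul, Nat.abs_cast]
        ring
      have hz1 : ‖z‖ ≤ 1 := by rw [hzn, div_le_one hs0]; exact hx
      have hb := Complex.exp_bound hz1 (n := 3) (by norm_num)
      have hzsq : z ^ 2 = ((-(j * t) ^ 2 / r ^ m : ℝ) : ℂ) := by
        rw [hz, ← hs2, mul_pow, Complex.I_sq]; push_cast; ring
      have heq : (c j : ℂ) * r ^ j * (Complex.exp z - 1 - z)
          - ((-(c j * j ^ 2 / 2) * t ^ 2 * (r ^ j / r ^ m) : ℝ) : ℂ)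
          = (c j : ℂ) * r ^ j * (Complex.exp z - ∑ k ∈ Finset.range 3, z ^ k / (k.factorial : ℂ)) := by
        simp only [Finset.sum_range_succ, Finset.sum_range_zero, hzsq]
        simp [Nat.factorial]
        ring
      rw [heq, norm_mul]
      have hb2 : ‖Complex.exp z - ∑ k ∈ Finset.range 3, z ^ k / (k.factorial : ℂ)‖ ≤ ‖z‖ ^ 3 := by
        refine hb.trans (mul_le_of_le_one_right (by positivity) ?_)
        norm_num [Nat.factorial]
      have hcr : ‖(c j : ℂ) * r ^ j‖ ≤ |c j| * s ^ 2 := by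
        rw [norm_mul, norm_pow, Complex.norm_real, Complex.norm_real, Real.norm_eq_abs,
          Real.norm_eq_abs, abs_of_pos hr0, hs2]
        gcongr
      calc _ ≤ |c j| * s ^ 2 * ‖z‖ ^ 3 := by gcongr
        _ = |c j| * |j * t| ^ 3 / s := by rw [hzn]; field_simp
    · exact tendsto_const_nhds.div_atTop (s_tendsto m hm)
  have := hmain.add hrem
  simp only [add_zero, add_sub_cancel] at this
  exact this

lemma int_tendsto (B : Finset ℕ) (c : ℕ → ℝ) (hc : ∀ j ∈ B, 0 < c j) (m : ℕ) (hmB : m ∈ B)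
    (hBpos : ∀ j ∈ B, 0 < j) (hmax : ∀ j ∈ B, j ≤ m)
    (hpos : ∀ θ : ℝ, θ ≠ 0 → |θ| ≤ Real.pi → 0 < ∑ j ∈ B, c j * (1 - Real.cos (j * θ)))
    (g : ℝ → ℂ) (hg : Continuous g) (hg0 : g 0 = 1) (hg1 : ∀ x, ‖g x‖ ≤ 1) :
    Tendsto (fun r : ℝ => √(r ^ m) • ∫ θ in (-Real.pi)..Real.pi, Complex.exp (E B c r θ) * g θ) atTop
      (nhds (∫ t : ℝ, Complex.exp (((-(c m * m ^ 2 / 2) * t ^ 2 : ℝ) : ℂ)))) := by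
  have hm := hBpos m hmB
  have hpi := Real.pi_pos
  obtain ⟨δ, hδ0, hδ⟩ := exists_delta B c m hm hpos
  have key : Tendsto (fun r : ℝ => ∫ t : ℝ, (Set.Ioc (-(Real.pi * √(r ^ m))) (Real.pi * √(r ^ m))).indicator
      (fun t => Complex.exp (E B c r (t / √(r ^ m))) * g (t / √(r ^ m))) t) atTop
      (nhds (∫ t : ℝ, Complex.exp (((-(c m * m ^ 2 / 2) * t ^ 2 : ℝ) : ℂ)))) := by
    apply MeasureTheory.tendsto_integral_filter_of_dominated_convergence
      (fun t => (1 + 1 / (2 * c m * m ^ 2 / Real.pi ^ 2)) * (1 + t ^ 2)⁻¹)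
    · refine Eventually.of_forall fun r => ?_
      apply MeasureTheory.AEStronglyMeasurable.indicator _ measurableSet_Ioc
      apply Continuous.aestronglyMeasurable
      have := E_cont B c r
      fun_prop
    · have hev : ∀ᶠ r : ℝ in atTop, Real.exp (-(δ * r)) * (1 + Real.pi ^ 2 * r ^ m) ≤ 1 := by
        have hδr : Tendsto (fun r : ℝ => δ * r) atTop atTop := tendsto_id.const_mul_atTop hδ0
        have h1 := (Real.tendsto_pow_mul_exp_neg_atTop_nhds_zero 0).comp hδr
        have h2 := ((Real.tendsto_pow_mul_exp_neg_atTop_nhds_zero m).comp hδr).const_mul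
          (Real.pi ^ 2 / δ ^ m)
        have h3 := h1.add h2
        simp only [mul_zero, add_zero] at h3
        have h4 := h3.eventually_le_const zero_lt_one
        filter_upwards [h4] with r hr
        refine le_trans (le_of_eq ?_) hr
        simp only [Function.comp, mul_pow]
        field_simp
      filter_upwards [hev, eventually_ge_atTop 1] with r hr hr1
      refine Eventually.of_forall fun t => ?_
      have hcm := hc m hmB
      by_cases ht : t ∈ Set.Ioc (-(Real.pi * √(r ^ m))) (Real.pi * √(r ^ m))
      · rw [Set.indicator_of_mem ht, norm_mul]
        refine (mul_le_of_le_one_right (norm_nonneg _) (hg1 _)).trans ?_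
        exact bound B c hc m hmB hm hBpos δ hδ r hr1 hr t (abs_le.2 ⟨ht.1.le, ht.2⟩)
      · rw [Set.indicator_of_notMem ht, norm_zero]
        positivity
    · exact integrable_inv_one_add_sq.const_mul _
    · refine Eventually.of_forall fun t => ?_
      have h1 := (Complex.continuous_exp.tendsto _).comp (E_tendsto B c m hmB hm hmax t)
      have h2 : Tendsto (fun r : ℝ => g (t / √(r ^ m))) atTop (nhds 1) := by
        rw [← hg0]
        exact (hg.tendsto 0).comp (tendsto_const_nhds.div_atTop (s_tendsto m hm))
      have h3 := h1.mul h2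
      rw [mul_one] at h3
      refine h3.congr' ?_
      have h5 := ((s_tendsto m hm).const_mul_atTop hpi).eventually_gt_atTop |t|
      filter_upwards [h5] with r hr
      have := abs_lt.1 hr
      rw [Set.indicator_of_mem (Set.mem_Ioc.2 ⟨this.1, this.2.le⟩)]
      rfl
  refine key.congr' ?_
  filter_upwards [(s_tendsto m hm).eventually_gt_atTop 0] with r hs
  rw [MeasureTheory.integral_indicator measurableSet_Ioc,
    ← intervalIntegral.integral_of_le (by nlinarith),
    intervalIntegral.integral_comp_div (fun θ => Complex.exp (E B c r θ) * g θ) hs.ne']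
  congr 2
  · field_simp
  · field_simp

lemma gauss_ne (a : ℝ) (ha : 0 < a) :
    (∫ t : ℝ, Complex.exp (((-a * t ^ 2 : ℝ) : ℂ))) ≠ 0 := by
  simp only [← Complex.ofReal_exp]
  rw [integral_complex_ofReal, integral_gaussian]
  have := Real.pi_pos
  exact_mod_cast (Real.sqrt_pos.2 (by positivity)).ne'

lemma int_eq (B : Finset ℕ) (c : ℕ → ℝ) (b : ℕ → ℝ)
    (hrep : ∀ w : ℝ, HasSum (fun n => b n * w ^ n) (Real.exp (∑ j ∈ B, c j * w ^ j)))
    (r : ℝ) (n k l : ℕ) (hkl : k + l = n) (hr : ∑ j ∈ B, (j : ℝ) * c j * r ^ j = n) :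
    ∫ θ in (-Real.pi)..Real.pi, Complex.exp (E B c r θ) * Complex.exp (l * θ * Complex.I)
      = Complex.exp (-∑ j ∈ B, (c j : ℂ) * r ^ j) * (2 * Real.pi * (b k * r ^ k)) := by
  rw [← cauchy _ _ (complex_ext B c b hrep) r k, ← intervalIntegral.integral_const_mul]
  congr 1
  funext θ
  rw [← Complex.exp_add, ← Complex.exp_add, ← Complex.exp_add]
  congr 1
  have hr' : ∑ j ∈ B, (j : ℂ) * c j * r ^ j = k + l := by
    have : (k : ℝ) + l = n := by exact_mod_cast hkl
    rw [← this] at hr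
    exact_mod_cast hr
  have h1 : E B c r θ = ∑ j ∈ B, (c j : ℂ) * (r * Complex.exp (θ * Complex.I)) ^ j
      - ∑ j ∈ B, (c j : ℂ) * r ^ j - (∑ j ∈ B, (j : ℂ) * c j * r ^ j) * (θ * Complex.I) := by
    unfold E
    rw [Finset.sum_mul, ← Finset.sum_sub_distrib, ← Finset.sum_sub_distrib]
    refine Finset.sum_congr rfl fun j _ => ?_
    rw [mul_pow, ← Complex.exp_nat_mul, mul_assoc (j : ℂ) (θ : ℂ)]
    ring
  rw [h1, hr']
  ring

end Stmt9

open Stmt9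

theorem stmt_9 (B : Finset ℕ) (hB : B.Nonempty) (hBpos : ∀ j ∈ B, 0 < j)
    (c : ℕ → ℝ) (hc : ∀ j ∈ B, 0 < c j) (b : ℕ → ℝ)
    (hrep : ∀ w : ℝ, HasSum (fun n => b n * w ^ n) (Real.exp (∑ j ∈ B, c j * w ^ j)))
    (hb : ∀ᶠ n in atTop, 0 < b n) :
    Tendsto (fun n : ℕ =>
        (b (n - 1) / b n) /
          (((n : ℝ) / ((B.max' hB : ℝ) * c (B.max' hB))) ^ ((B.max' hB : ℝ))⁻¹))
      atTop (nhds 1) := by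
  have hmB := B.max'_mem hB
  have hmax : ∀ j ∈ B, j ≤ B.max' hB := fun j hj => B.le_max' j hj
  generalize B.max' hB = m at hmB hmax ⊢
  have hm := hBpos m hmB
  have hcm := hc m hmB
  have hmR : (0 : ℝ) < m := by exact_mod_cast hm
  have hpos := pos_aux B c hc b hrep hb
  -- the saddle points
  set P : ℝ → ℝ := fun x => ∑ j ∈ B, (j : ℝ) * c j * x ^ j with hP
  have hPc : Continuous P := by rw [hP]; fun_prop
  have hP0 : P 0 = 0 := by
    rw [hP]
    refine Finset.sum_eq_zero fun j hj => ?_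
    rw [zero_pow (hBpos j hj).ne', mul_zero]
  have hPmono : ∀ x y, 0 ≤ x → x ≤ y → P x ≤ P y := by
    intro x y hx hxy
    refine Finset.sum_le_sum fun j hj => ?_
    have := (hc j hj).le
    gcongr
  have hPratio : Tendsto (fun x => P x / x ^ m) atTop (nhds (m * c m)) := by
    have hsum : (m * c m : ℝ) = ∑ j ∈ B, (if j = m then (m * c m : ℝ) else 0) := by
      rw [Finset.sum_ite_eq' B m, if_pos hmB]
    rw [hsum]
    simp only [hP, Finset.sum_div]
    refine tendsto_finsetSum _ fun j hj => ?_
    split_ifs with h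
    · subst h
      refine tendsto_const_nhds.congr' ?_
      filter_upwards [eventually_gt_atTop 0] with x hx
      field_simp
    · have := (tendsto_pow_div_pow_atTop_zero (𝕜 := ℝ)
        (lt_of_le_of_ne (hmax j hj) h)).const_mul ((j : ℝ) * c j)
      simpa [mul_div_assoc] using this
  have hPtop : Tendsto P atTop atTop := by
    have := hPratio.pos_mul_atTop (by positivity) (tendsto_pow_atTop (α := ℝ) hm.ne')
    refine this.congr' ?_
    filter_upwards [eventually_gt_atTop 0] with x hx
    field_simp
  have hex : ∀ n : ℕ, ∃ x : ℝ, 0 ≤ x ∧ P x = n := by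
    intro n
    obtain ⟨x, hx, h⟩ := intermediate_value_Ici (a := (0 : ℝ)) hPc.continuousOn hPtop
      (show (n : ℝ) ∈ Set.Ici (P 0) from Set.mem_Ici.2 (by rw [hP0]; positivity))
    exact ⟨x, hx, h⟩
  choose ρ hρ0 hρ using hex
  have hρtop : Tendsto ρ atTop atTop := by
    refine tendsto_atTop.2 fun M => ?_
    filter_upwards [tendsto_natCast_atTop_atTop.eventually_gt_atTop (P M)] with n hn
    by_contra! hlt
    have := hPmono _ _ (hρ0 n) hlt.le
    rw [hρ n] at this
    linarith
  -- integral asymptotics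
  have hg := gauss_ne (c m * m ^ 2 / 2) (by positivity)
  have hI0 := (int_tendsto B c hc m hmB hBpos hmax hpos
    (fun θ => Complex.exp ((0 : ℕ) * θ * Complex.I)) (by fun_prop) (by simp) (by simp)).comp hρtop
  have hI1 := (int_tendsto B c hc m hmB hBpos hmax hpos
    (fun θ => Complex.exp ((1 : ℕ) * θ * Complex.I)) (by fun_prop) (by simp) (by
      intro x; simp [Complex.norm_exp_ofReal_mul_I])).comp hρtop
  have hQ := hI1.div hI0 hg
  rw [div_self hg] at hQ
  have hQ2 : Tendsto (fun n : ℕ => ((b (n - 1) / b n / ρ n : ℝ) : ℂ)) atTop (nhds 1) := by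
    refine hQ.congr' ?_
    filter_upwards [hb, eventually_ge_atTop 1, hρtop.eventually_gt_atTop 0] with n hbn hn hrn
    simp only [Function.comp, Pi.div_apply]
    rw [int_eq B c b hrep (ρ n) n n 0 (by omega) (hρ n),
      int_eq B c b hrep (ρ n) n (n - 1) 1 (by omega) (hρ n)]
    have hs : (√(ρ n ^ m) : ℂ) ≠ 0 := by
      exact_mod_cast (Real.sqrt_pos.2 (by positivity)).ne'
    have he := Complex.exp_ne_zero (-∑ j ∈ B, (c j : ℂ) * (ρ n : ℂ) ^ j)
    have hbn' : (b n : ℂ) ≠ 0 := by exact_mod_cast hbn.ne'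
    have hrn' : (ρ n : ℂ) ≠ 0 := by exact_mod_cast hrn.ne'
    have hpi : (Real.pi : ℂ) ≠ 0 := by exact_mod_cast Real.pi_pos.ne'
    rw [Complex.real_smul, Complex.real_smul]
    have hpw : (ρ n : ℂ) ^ n = ρ n ^ (n - 1) * ρ n := by
      rw [← pow_succ]; congr 1; omega
    rw [hpw]
    push_cast
    field_simp
  have hQ3 : Tendsto (fun n : ℕ => b (n - 1) / b n / ρ n) atTop (nhds 1) := by
    have := (Complex.continuous_re.tendsto _).comp hQ2
    simpa [Function.comp_def] using this
  have hR : Tendsto (fun n : ℕ => ρ n / ((n : ℝ) / (m * c m)) ^ (m : ℝ)⁻¹) atTop (nhds 1) := by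
    have h1 := ((hPratio.comp hρtop).div_const (m * c m))
    rw [div_self (by positivity)] at h1
    have h2 := (h1.rpow_const (p := (m : ℝ)⁻¹) (Or.inl one_ne_zero)).inv₀ (by simp)
    simp only [Real.one_rpow, inv_one] at h2
    refine h2.congr' ?_
    filter_upwards [eventually_ge_atTop 1, hρtop.eventually_gt_atTop 0] with n hn hrn
    simp only [Function.comp, hρ]
    rw [div_right_comm, Real.div_rpow (by positivity) (by positivity),
      Real.pow_rpow_inv_natCast hrn.le hm.ne', inv_div]
  have := hQ3.mul hR
  rw [mul_one] at this
  refine this.congr' ?_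
  filter_upwards [hρtop.eventually_gt_atTop 0] with n hrn
  rw [div_mul_div_cancel₀ hrn.ne']
end

section
/- Let A be a finite set of positive integers with max A = d and gcd(A) = p. Then, as n → ∞ along multiples of p, the ratio (|S_{n-p}^{(A)}|/(n-p)!) / (|S_n^{(A)}|/n!) is asymptotically equivalent to n^{p/d}. -/
open Filter

noncomputable def permCount (A : Set ℕ) (n : ℕ) : ℕ :=
  Nat.card {σ : Equiv.Perm (Fin n) // ∀ x, Function.minimalPeriod ⇑σ x ∈ A}

lemma minper_fixed {n : ℕ} (σ : Equiv.Perm (Fin n)) (x : Fin n) (h : σ x = x) :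
    Function.minimalPeriod ⇑σ x = 1 :=
  Function.minimalPeriod_eq_one_iff_isFixedPt.2 h

lemma minper_nonfixed {n : ℕ} (σ : Equiv.Perm (Fin n)) (x : Fin n) (h : σ x ≠ x) :
    Function.minimalPeriod ⇑σ x = (σ.cycleOf x).support.card := by
  have hc := Equiv.Perm.isCycle_cycleOf σ h
  rw [← hc.orderOf]
  have key : ∀ k, Function.IsPeriodicPt σ k x ↔ (σ.cycleOf x) ^ k = 1 := by
    intro k
    rw [hc.pow_eq_one_iff' (x := x) (by simpa using h), Equiv.Perm.cycleOf_pow_apply_self]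
    simp [Function.IsPeriodicPt, Function.IsFixedPt, Equiv.Perm.iterate_eq_pow]
  apply Nat.dvd_antisymm
  · exact ((key _).2 (pow_orderOf_eq_one _)).minimalPeriod_dvd
  · exact orderOf_dvd_of_pow_eq_one ((key _).1 (Function.isPeriodicPt_minimalPeriod _ _))

lemma minper_mem_iff {n : ℕ} (A : Set ℕ) (σ : Equiv.Perm (Fin n)) :
    (∀ x, Function.minimalPeriod ⇑σ x ∈ A) ↔ ∀ j ∈ σ.partition.parts, j ∈ A := by
  rw [Equiv.Perm.parts_partition]
  constructor
  · intro h j hj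
    rcases Multiset.mem_add.1 hj with hj | hj
    · rw [Equiv.Perm.cycleType_def, Multiset.mem_map] at hj
      obtain ⟨c, hc, rfl⟩ := hj
      have hc' : c ∈ σ.cycleFactorsFinset := hc
      have hcc := (Equiv.Perm.mem_cycleFactorsFinset_iff.1 hc').1
      obtain ⟨x, hx⟩ := hcc.nonempty_support
      have := Equiv.Perm.cycle_is_cycleOf hx hc'
      have hx2 : σ x ≠ x := by
        have := Equiv.Perm.mem_cycleFactorsFinset_support_le hc' hx
        simpa using this
      have h3 := h x
      rw [minper_nonfixed σ x hx2, ← this] at h3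
      exact h3
    · have h1 := Multiset.eq_of_mem_replicate hj
      subst h1
      have h2 : Fintype.card (Fin n) - σ.support.card ≠ 0 := by
        intro h0; rw [h0] at hj; simp at hj
      have : σ.support ≠ Finset.univ := by
        intro h; rw [h] at h2; simp at h2
      obtain ⟨x, hx⟩ : ∃ x, x ∉ σ.support := by
        by_contra hcon; push Not at hcon
        exact this (Finset.eq_univ_iff_forall.2 hcon)
      have h3 := h x
      rwa [minper_fixed σ x (by simpa using hx)] at h3
  · intro h x
    by_cases hx : σ x = x
    · rw [minper_fixed σ x hx]
      apply h
      apply Multiset.mem_add.2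
      right
      rw [Multiset.mem_replicate]
      refine ⟨?_, rfl⟩
      have : σ.support.card < Fintype.card (Fin n) := by
        apply Finset.card_lt_univ_of_notMem (x := x)
        simpa using hx
      omega
    · rw [minper_nonfixed σ x hx]
      apply h
      apply Multiset.mem_add.2
      left
      rw [Equiv.Perm.cycleType_def, Multiset.mem_map]
      exact ⟨σ.cycleOf x, Finset.mem_def.1
        (Equiv.Perm.cycleOf_mem_cycleFactorsFinset_iff.2 (by simpa using hx)), rfl⟩

noncomputable def zz (m : Multiset ℕ) : ℝ := (m.prod : ℝ) * ∏ j ∈ m.toFinset, ((m.count j).factorial : ℝ)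

lemma zz_eq (m : Multiset ℕ) (S : Finset ℕ) (h : m.toFinset ⊆ S) :
    zz m = (m.prod : ℝ) * ∏ j ∈ S, ((m.count j).factorial : ℝ) := by
  unfold zz
  congr 1
  apply Finset.prod_subset h
  intro x _ hx
  have : m.count x = 0 := by rw [Multiset.count_eq_zero]; simpa using hx
  simp [this]

lemma zz_cons (j : ℕ) (m : Multiset ℕ) : zz (j ::ₘ m) = j * (m.count j + 1) * zz m := by
  rw [zz_eq (j ::ₘ m) (insert j m.toFinset) (by simp), zz_eq m (insert j m.toFinset) (by simp)]
  rw [← Finset.mul_prod_erase _ _ (Finset.mem_insert_self j m.toFinset),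
    ← Finset.mul_prod_erase _ _ (Finset.mem_insert_self j m.toFinset)]
  have : ∏ x ∈ (insert j m.toFinset).erase j, (((j ::ₘ m).count x).factorial : ℝ)
      = ∏ x ∈ (insert j m.toFinset).erase j, ((m.count x).factorial : ℝ) := by
    apply Finset.prod_congr rfl
    intro x hx
    rw [Multiset.count_cons_of_ne (Finset.ne_of_mem_erase hx)]
  rw [this, Multiset.count_cons_self, Nat.factorial_succ, Multiset.prod_cons]
  push_cast
  ring

lemma zz_pos (m : Multiset ℕ) (h : ∀ j ∈ m, 0 < j) : 0 < zz m := by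
  unfold zz
  have : 0 < m.prod := Multiset.prod_pos h
  positivity

lemma zz_add_ones (m : Multiset ℕ) (k : ℕ) (h : 1 ∉ m) :
    zz (m + Multiset.replicate k 1) = k.factorial * zz m := by
  induction k with
  | zero => simp
  | succ k ih =>
    rw [Multiset.replicate_succ, Multiset.add_cons, zz_cons, ih]
    have : m.count 1 = 0 := Multiset.count_eq_zero.2 h
    simp [this, Nat.factorial_succ]
    ring

lemma fiber_card {n : ℕ} (P : (Fintype.card (Fin n)).Partition) :
    ((Finset.univ.filter (fun σ : Equiv.Perm (Fin n) => σ.partition = P)).card : ℝ)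
      = n.factorial / zz P.parts := by
  classical
  set m := P.parts.filter (2 ≤ ·) with hm
  have hparts : P.parts = m + Multiset.replicate (P.parts.count 1) 1 := by
    conv_lhs => rw [← Multiset.filter_add_not (2 ≤ ·) P.parts]
    congr 1
    rw [← Multiset.filter_eq']
    apply Multiset.filter_congr
    intro x hx
    have := P.parts_pos hx
    omega
  have hsum : m.sum + P.parts.count 1 = n := by
    have := P.parts_sum
    rw [hparts] at this
    rw [Multiset.sum_add] at this
    simpa using this
  have h1 : (1:ℕ) ∉ m := by simp [hm]
  have hset : (Finset.univ.filter (fun σ : Equiv.Perm (Fin n) => σ.partition = P))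
      = Finset.univ.filter (fun σ : Equiv.Perm (Fin n) => σ.cycleType = m) := by
    ext σ
    simp only [Finset.mem_filter, Finset.mem_univ, true_and]
    constructor
    · rintro rfl
      exact (Equiv.Perm.filter_parts_partition_eq_cycleType).symm
    · intro h
      apply Nat.Partition.ext
      rw [Equiv.Perm.parts_partition, hparts, ← Equiv.Perm.sum_cycleType, h]
      congr 2
      have := Fintype.card_fin n
      omega
  rw [hset]
  have := Equiv.Perm.card_of_cycleType_mul_eq (Fin n) m
  rw [if_pos ⟨by simp; omega, by simp [hm]⟩, Fintype.card_fin] at this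
  rw [hparts, zz_add_ones _ _ h1, eq_div_iff]
  · have h2 : n - m.sum = P.parts.count 1 := by omega
    rw [h2] at this
    rw [← this]
    unfold zz
    push_cast
    ring
  · have : 0 < zz m := zz_pos _ (fun j hj => P.parts_pos (Multiset.mem_of_mem_filter hj))
    positivity

lemma permCount_eq (A : Finset ℕ) (n : ℕ) :
    (permCount ↑A n : ℝ) / n.factorial
      = ∑ P : n.Partition, if (∀ j ∈ P.parts, j ∈ A) then 1 / zz P.parts else 0 := by
  classical
  have key : (permCount ↑A n : ℝ) / n.factorial
      = ∑ P : (Fintype.card (Fin n)).Partition,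
        if (∀ j ∈ P.parts, j ∈ A) then 1 / zz P.parts else 0 := by
    unfold permCount
    rw [Nat.card_eq_fintype_card, Fintype.card_subtype]
    rw [Finset.card_eq_sum_card_fiberwise (f := fun σ => σ.partition) (t := Finset.univ) (by simp)]
    push_cast
    rw [Finset.sum_div]
    apply Finset.sum_congr rfl
    intro P _
    rw [Finset.filter_filter]
    split_ifs with h
    · have : (Finset.univ.filter (fun σ : Equiv.Perm (Fin n) =>
          (∀ x, Function.minimalPeriod ⇑σ x ∈ (A : Set ℕ)) ∧ σ.partition = P))
          = (Finset.univ.filter (fun σ : Equiv.Perm (Fin n) => σ.partition = P)) := by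
        apply Finset.filter_congr
        intro σ _
        rw [minper_mem_iff]
        constructor
        · exact fun h => h.2
        · rintro rfl; exact ⟨h, rfl⟩
      rw [this, fiber_card]
      field_simp
    · have : (Finset.univ.filter (fun σ : Equiv.Perm (Fin n) =>
          (∀ x, Function.minimalPeriod ⇑σ x ∈ (A : Set ℕ)) ∧ σ.partition = P)) = ∅ := by
        apply Finset.filter_eq_empty_iff.2
        rintro σ _ ⟨h1, rfl⟩
        rw [minper_mem_iff] at h1
        exact h h1
      rw [this]
      simp
  rw [key]
  rw [Fintype.card_fin]

lemma permCount_zero (A : Finset ℕ) : (permCount ↑A 0 : ℝ) / (Nat.factorial 0) = 1 := by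
  unfold permCount
  simp

lemma permCount_rec (A : Finset ℕ) (hApos : ∀ a ∈ A, 0 < a) (n : ℕ) :
    (n : ℝ) * ((permCount ↑A n : ℝ) / n.factorial)
      = ∑ j ∈ A.filter (· ≤ n), (permCount ↑A (n - j) : ℝ) / (n - j).factorial := by
  classical
  rw [permCount_eq, Finset.mul_sum]
  have step : ∀ P : n.Partition,
      (n : ℝ) * (if (∀ j ∈ P.parts, j ∈ A) then 1 / zz P.parts else 0)
      = ∑ j ∈ A.filter (· ≤ n), if (∀ i ∈ P.parts, i ∈ A) ∧ j ∈ P.parts then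
          1 / zz (P.parts.erase j) else 0 := by
    intro P
    by_cases h : ∀ j ∈ P.parts, j ∈ A
    · rw [if_pos h]
      have hn : (n : ℝ) = ∑ j ∈ A.filter (· ≤ n), (P.parts.count j : ℝ) * j := by
        have h1 : n = ∑ j ∈ A.filter (· ≤ n), P.parts.count j * j := by
          conv_lhs => rw [← P.parts_sum, Finset.sum_multiset_count]
          simp only [smul_eq_mul]
          apply Finset.sum_subset
          · intro j hj
            have hj : j ∈ P.parts := by simpa using hj
            exact Finset.mem_filter.2 ⟨h j hj, Nat.Partition.le_of_mem_parts hj⟩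
          · intro j _ hj
            have : P.parts.count j = 0 := by rw [Multiset.count_eq_zero]; simpa using hj
            simp [this]
        exact_mod_cast h1
      rw [hn, Finset.sum_mul]
      apply Finset.sum_congr rfl
      intro j hj
      by_cases hjP : j ∈ P.parts
      · rw [if_pos ⟨h, hjP⟩]
        have hz := zz_cons j (P.parts.erase j)
        rw [Multiset.cons_erase hjP] at hz
        have hc : (P.parts.count j : ℝ) = ((P.parts.erase j).count j : ℝ) + 1 := by
          rw [Multiset.count_erase_self]
          have := Multiset.count_pos.2 hjP
          have h2 : P.parts.count j = (P.parts.count j - 1) + 1 := by omega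
          exact_mod_cast h2
        rw [hz, hc]
        have h3 : 0 < zz (P.parts.erase j) :=
          zz_pos _ (fun i hi => P.parts_pos (Multiset.mem_of_mem_erase hi))
        have h4 : (0:ℝ) < j := by exact_mod_cast P.parts_pos hjP
        field_simp
      · rw [if_neg (fun hh => hjP hh.2), Multiset.count_eq_zero.2 hjP]
        simp
    · rw [if_neg h]
      symm
      rw [mul_zero]
      apply Finset.sum_eq_zero
      intro j _
      rw [if_neg (fun hh => h hh.1)]
  simp_rw [step]
  rw [Finset.sum_comm]
  apply Finset.sum_congr rfl
  intro j hj
  obtain ⟨hjA, hjn⟩ := Finset.mem_filter.1 hj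
  rw [permCount_eq]
  have hj1 : 1 ≤ j := hApos j hjA
  rw [← Finset.sum_filter_add_sum_filter_not _ (fun P : n.Partition => j ∈ P.parts)]
  rw [Finset.sum_eq_zero (s := Finset.univ.filter (fun P : n.Partition => ¬ j ∈ P.parts)), add_zero]
  · rw [← Finset.sum_subtype_eq_sum_filter, Finset.subtype_univ]
    apply Fintype.sum_equiv (Nat.Partition.partitionWithPartEquiv hj1 hjn)
    rintro ⟨P, hP⟩
    simp only [hP, and_true, Nat.Partition.partitionWithPartEquiv_apply_parts]
    have : (∀ i ∈ P.parts, i ∈ A) ↔ ∀ i ∈ P.parts.erase j, i ∈ A := by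
      conv_lhs => rw [← Multiset.cons_erase hP]
      simp [hjA]
    simp only [this]
  · intro P hP
    rw [if_neg]
    intro hh
    exact (Finset.mem_filter.1 hP).2 hh.2

noncomputable def Qc (B : Finset ℕ) (q : ℝ) (z : ℂ) : ℂ := ∑ j ∈ B, z ^ j / ((q : ℂ) * j)

lemma Qc_hasDerivAt (B : Finset ℕ) (hB : ∀ j ∈ B, 0 < j) (q : ℝ) (hq : 0 < q) (z : ℂ) :
    HasDerivAt (Qc B q) (∑ j ∈ B, z ^ (j - 1) / (q : ℂ)) z := by
  unfold Qc
  apply HasDerivAt.fun_sum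
  intro j hj
  have h := (hasDerivAt_pow j z).div_const ((q : ℂ) * j)
  refine h.congr_deriv ?_
  have h1 : (j : ℂ) ≠ 0 := by exact_mod_cast (hB j hj).ne'
  have h2 : (q : ℂ) ≠ 0 := by exact_mod_cast hq.ne'
  field_simp

noncomputable def II (B : Finset ℕ) (q x : ℝ) (m : ℤ) : ℂ :=
  ∮ z in C(0, x), Complex.exp (Qc B q z) * z ^ (-m - 1)

lemma Qc_diff (B : Finset ℕ) (hB : ∀ j ∈ B, 0 < j) (q : ℝ) (hq : 0 < q) :
    Differentiable ℂ (fun z => Complex.exp (Qc B q z)) := by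
  intro z
  exact (Qc_hasDerivAt B hB q hq z).differentiableAt.cexp

lemma II_neg (B : Finset ℕ) (hB : ∀ j ∈ B, 0 < j) (q x : ℝ) (hq : 0 < q) (hx : 0 < x)
    (m : ℤ) (hm : m < 0) : II B q x m = 0 := by
  unfold II
  obtain ⟨k, hk⟩ : ∃ k : ℕ, -m - 1 = (k : ℤ) := ⟨(-m - 1).toNat, by omega⟩
  rw [hk]
  simp only [zpow_natCast]
  apply DiffContOnCl.circleIntegral_eq_zero hx.le
  apply Differentiable.diffContOnCl
  exact (Qc_diff B hB q hq).mul (differentiable_pow k)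

lemma II_zero (B : Finset ℕ) (hB : ∀ j ∈ B, 0 < j) (q x : ℝ) (hq : 0 < q) (hx : 0 < x) :
    II B q x 0 = 2 * Real.pi * Complex.I := by
  unfold II
  have h := DiffContOnCl.circleIntegral_sub_inv_smul (R := x) (c := 0) (w := 0)
    (Qc_diff B hB q hq).diffContOnCl (by simpa using hx)
  have h0 : Qc B q 0 = 0 := by
    unfold Qc
    apply Finset.sum_eq_zero
    intro j hj
    simp [(hB j hj).ne']
  simp only [sub_zero, smul_eq_mul, h0, Complex.exp_zero, mul_one] at h
  rw [← h]
  congr 1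
  ext z
  simp [mul_comm]

lemma II_rec (B : Finset ℕ) (hB : ∀ j ∈ B, 0 < j) (q x : ℝ) (hq : 0 < q) (hx : 0 < x) (m : ℤ) :
    (q : ℂ) * m * II B q x m = ∑ j ∈ B, II B q x (m - j) := by
  have hq' : (q : ℂ) ≠ 0 := by exact_mod_cast hq.ne'
  have hcont : ∀ k : ℤ, CircleIntegrable (fun z => Complex.exp (Qc B q z) * z ^ k) 0 x := by
    intro k
    apply ContinuousOn.circleIntegrable hx.le
    apply (Qc_diff B hB q hq).continuous.continuousOn.mul
    intro z hz
    have : z ≠ 0 := by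
      rintro rfl
      simp at hz
      exact hx.ne hz
    exact (continuousAt_zpow₀ z k (Or.inl this)).continuousWithinAt
  have h := circleIntegral.integral_eq_zero_of_hasDerivWithinAt (c := 0) (R := x) hx.le
    (f := fun z => Complex.exp (Qc B q z) * z ^ (-m))
    (f' := fun z => (q : ℂ)⁻¹ * (∑ j ∈ B, Complex.exp (Qc B q z) * z ^ (-(m - j) - 1))
      - (m : ℂ) * (Complex.exp (Qc B q z) * z ^ (-m - 1))) (by
    intro z hz
    have hz0 : z ≠ 0 := by
      rintro rfl
      simp at hz
      exact hx.ne hz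
    apply HasDerivAt.hasDerivWithinAt
    have h1 := (Qc_hasDerivAt B hB q hq z).cexp.mul (hasDerivAt_zpow (-m) z (Or.inl hz0))
    refine h1.congr_deriv ?_
    symm
    rw [Finset.mul_sum, Finset.mul_sum, Finset.sum_mul]
    push_cast
    rw [sub_eq_add_neg]
    congr 1
    · apply Finset.sum_congr rfl
      intro j hj
      have : z ^ (-(m - (j:ℤ)) - 1) = z ^ (j - 1) * z ^ (-m) := by
        rw [← zpow_natCast, ← zpow_add₀ hz0]
        congr 1
        have := hB j hj
        push_cast [Nat.cast_sub (show 1 ≤ j from this)]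
        ring
      rw [this]
      field_simp
    · ring)
  rw [circleIntegral.integral_sub] at h
  · rw [circleIntegral.integral_const_mul, circleIntegral.integral_const_mul,
      circleIntegral.integral_fun_sum] at h
    · unfold II
      have h2 := sub_eq_zero.1 h
      rw [mul_assoc, ← h2, ← mul_assoc, mul_inv_cancel₀ hq', one_mul]
    · intro j _
      exact hcont _
  · have := CircleIntegrable.sum B (c := 0) (R := x)
      (f := fun j : ℕ => fun z => Complex.exp (Qc B q z) * z ^ (-(m - (j:ℤ)) - 1)) (fun j _ => hcont _)
    have h3 := CircleIntegrable.const_smul (a := (q : ℂ)⁻¹) this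
    have h4 : (fun z => (q : ℂ)⁻¹ * (∑ j ∈ B, Complex.exp (Qc B q z) * z ^ (-(m - j) - 1)))
        = (q : ℂ)⁻¹ • (∑ j ∈ B, fun z => Complex.exp (Qc B q z) * z ^ (-(m - (j:ℤ)) - 1)) := by
      ext z
      simp
    rw [h4]
    exact h3
  · exact CircleIntegrable.const_smul (a := (m : ℂ)) (hcont _)

lemma coef_eq (B : Finset ℕ) (hB : ∀ j ∈ B, 0 < j) (q x : ℝ) (hq : 0 < q) (hx : 0 < x)
    (b : ℕ → ℝ) (hb0 : b 0 = 1)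
    (hb : ∀ m : ℕ, q * m * b m = ∑ j ∈ B.filter (· ≤ m), b (m - j)) (m : ℕ) :
    II B q x m = 2 * Real.pi * Complex.I * b m := by
  induction m using Nat.strong_induction_on with
  | _ m ih =>
  rcases Nat.eq_zero_or_pos m with rfl | hm
  · rw [hb0]; simpa using II_zero B hB q x hq hx
  · have h := II_rec B hB q x hq hx m
    have h1 : ∑ j ∈ B, II B q x ((m:ℤ) - j)
        = ∑ j ∈ B.filter (· ≤ m), 2 * Real.pi * Complex.I * (b (m - j) : ℂ) := by
      rw [Finset.sum_filter]
      apply Finset.sum_congr rfl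
      intro j hj
      split_ifs with hjm
      · rw [← ih (m - j) (by have := hB j hj; omega)]
        congr 1
        push_cast [Nat.cast_sub hjm]; ring
      · exact II_neg B hB q x hq hx _ (by omega)
    rw [h1, ← Finset.mul_sum] at h
    have h2 : (q : ℂ) * m * b m = ∑ j ∈ B.filter (· ≤ m), (b (m - j) : ℂ) := by
      exact_mod_cast hb m
    rw [← h2] at h
    have hq' : (q : ℂ) ≠ 0 := by exact_mod_cast hq.ne'
    have hm' : (m : ℂ) ≠ 0 := by exact_mod_cast hm.ne'
    apply mul_left_cancel₀ (mul_ne_zero hq' hm')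
    push_cast at h
    rw [h]; ring

lemma coef_int (B : Finset ℕ) (hB : ∀ j ∈ B, 0 < j) (q x : ℝ) (hq : 0 < q) (hx : 0 < x)
    (b : ℕ → ℝ) (hb0 : b 0 = 1)
    (hb : ∀ m : ℕ, q * m * b m = ∑ j ∈ B.filter (· ≤ m), b (m - j)) (m : ℕ) :
    ∫ θ in (-Real.pi)..Real.pi, Complex.exp (Qc B q (x * Complex.exp (θ * Complex.I)) - m * θ * Complex.I)
      = 2 * Real.pi * b m * x ^ m := by
  have h := coef_eq B hB q x hq hx b hb0 hb m
  unfold II circleIntegral at h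
  have hx' : (x : ℂ) ≠ 0 := by exact_mod_cast hx.ne'
  have h1 : ∀ θ : ℝ, deriv (circleMap 0 x) θ • (Complex.exp (Qc B q (circleMap 0 x θ)) *
      circleMap 0 x θ ^ (-(m:ℤ) - 1)) =
      (Complex.I / x ^ m) * Complex.exp (Qc B q (x * Complex.exp (θ * Complex.I)) - m * θ * Complex.I) := by
    intro θ
    have hne : circleMap 0 x θ ≠ 0 := by simp [hx.ne']
    rw [deriv_circleMap, smul_eq_mul, zpow_sub_one₀ hne, zpow_neg, zpow_natCast, Complex.exp_sub,
      mul_assoc (m:ℂ), Complex.exp_nat_mul]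
    have h2 : circleMap 0 x θ = x * Complex.exp (θ * Complex.I) := by simp [circleMap]
    rw [h2]
    have := Complex.exp_ne_zero (θ * Complex.I)
    rw [mul_pow]
    field_simp
  simp_rw [h1] at h
  rw [intervalIntegral.integral_const_mul] at h
  have hper : Function.Periodic (fun θ : ℝ => Complex.exp (Qc B q (x * Complex.exp (θ * Complex.I))
      - m * θ * Complex.I)) (2 * Real.pi) := by
    intro θ
    have e1 : Complex.exp (((θ + 2 * Real.pi : ℝ) : ℂ) * Complex.I) = Complex.exp (θ * Complex.I) := by
      rw [Complex.exp_eq_exp_iff_exists_int]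
      exact ⟨1, by push_cast; ring⟩
    simp only [e1]
    rw [Complex.exp_eq_exp_iff_exists_int]
    exact ⟨-m, by push_cast; ring⟩
  have h3 := hper.intervalIntegral_add_eq (-Real.pi) 0
  rw [show -Real.pi + 2 * Real.pi = Real.pi by ring, zero_add] at h3
  rw [h3]
  generalize (∫ θ in (0:ℝ)..(2 * Real.pi),
    Complex.exp (Qc B q (x * Complex.exp (θ * Complex.I)) - m * θ * Complex.I)) = J at h
  have hI := Complex.I_ne_zero
  have hxm : (x : ℂ) ^ m ≠ 0 := pow_ne_zero _ hx'
  field_simp at h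
  rw [h]
  ring

lemma Qc_polar (B : Finset ℕ) (q x θ : ℝ) :
    Qc B q (x * Complex.exp (θ * Complex.I))
      = ∑ j ∈ B, ((x ^ j / (q * j) : ℝ) : ℂ) * Complex.exp (((j * θ : ℝ) : ℂ) * Complex.I) := by
  unfold Qc
  apply Finset.sum_congr rfl
  intro j _
  rw [mul_pow, ← Complex.exp_nat_mul]
  push_cast
  rw [mul_assoc (j:ℂ)]
  ring

lemma Qc_real (B : Finset ℕ) (q x : ℝ) :
    Qc B q x = ((∑ j ∈ B, x ^ j / (q * j) : ℝ) : ℂ) := by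
  unfold Qc
  push_cast
  rfl

noncomputable def EE (B : Finset ℕ) (q k x θ : ℝ) : ℂ :=
  Qc B q (x * Complex.exp (θ * Complex.I)) - Qc B q x
    - (((∑ j ∈ B, x ^ j) / q - k : ℝ) : ℂ) * θ * Complex.I

lemma EE_re (B : Finset ℕ) (q k x θ : ℝ) :
    (EE B q k x θ).re = - ∑ j ∈ B, x ^ j / (q * j) * (1 - Real.cos (j * θ)) := by
  unfold EE
  rw [Qc_polar, Qc_real, Complex.sub_re, Complex.sub_re, Complex.ofReal_re, Complex.re_sum]
  have h1 : ((((∑ j ∈ B, x ^ j) / q - k : ℝ) : ℂ) * θ * Complex.I).re = 0 := by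
    rw [← Complex.ofReal_mul, Complex.re_ofReal_mul]; simp
  rw [h1, sub_zero, ← Finset.sum_sub_distrib, ← Finset.sum_neg_distrib]
  apply Finset.sum_congr rfl
  intro j _
  rw [Complex.re_ofReal_mul, Complex.exp_ofReal_mul_I_re]
  ring

lemma cos_gcd (B : Finset ℕ) (hg : B.gcd id = 1) (θ : ℝ) (hθ : |θ| ≤ Real.pi)
    (h : ∀ j ∈ B, Real.cos (j * θ) = 1) : θ = 0 := by
  have h1 : addOrderOf (θ : Real.Angle) ∣ B.gcd id := by
    apply Finset.dvd_gcd
    intro j hj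
    apply addOrderOf_dvd_of_nsmul_eq_zero
    obtain ⟨n, hn⟩ := (Real.cos_eq_one_iff _).1 (h j hj)
    simp only [id]
    rw [← Real.Angle.natCast_mul_eq_nsmul, Real.Angle.coe_eq_zero_iff]
    exact ⟨n, by rw [← hn]; simp⟩
  rw [hg, Nat.dvd_one, AddMonoid.addOrderOf_eq_one_iff, Real.Angle.coe_eq_zero_iff] at h1
  obtain ⟨n, hn⟩ := h1
  rw [zsmul_eq_mul] at hn
  have hpi := Real.pi_pos
  have h2 : |(n:ℝ)| < 1 := by
    rw [← hn, abs_mul, abs_of_pos (by positivity : (0:ℝ) < 2 * Real.pi)] at hθ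
    nlinarith
  have h3 : n = 0 := by
    have : |n| < 1 := by exact_mod_cast h2
    exact Int.abs_lt_one_iff.1 this
  rw [← hn, h3]; simp

lemma dom1 (B : Finset ℕ) (hB : ∀ j ∈ B, 0 < j) (hg : B.gcd id = 1) (q δ : ℝ) (hq : 0 < q)
    (hδ : 0 < δ) :
    ∃ c > 0, ∀ θ : ℝ, δ ≤ |θ| → |θ| ≤ Real.pi → c ≤ ∑ j ∈ B, 1 / (q * j) * (1 - Real.cos (j * θ)) := by
  set f : ℝ → ℝ := fun θ => ∑ j ∈ B, 1 / (q * j) * (1 - Real.cos (j * θ)) with hf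
  have hcont : Continuous f := by
    rw [hf]; fun_prop
  have hK : IsCompact (Set.Icc (-Real.pi) Real.pi ∩ {θ | δ ≤ |θ|}) :=
    isCompact_Icc.inter_right (isClosed_le continuous_const continuous_abs)
  have hnn : ∀ θ, ∀ j ∈ B, 0 ≤ 1 / (q * j) * (1 - Real.cos (j * θ)) := by
    intro θ j _
    have := Real.cos_le_one (j * θ)
    have : 0 ≤ 1 - Real.cos (j * θ) := by linarith
    positivity
  rcases Set.eq_empty_or_nonempty (Set.Icc (-Real.pi) Real.pi ∩ {θ | δ ≤ |θ|}) with he | hne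
  · refine ⟨1, one_pos, fun θ h1 h2 => ?_⟩
    have : θ ∈ (Set.Icc (-Real.pi) Real.pi ∩ {θ | δ ≤ |θ|}) := ⟨abs_le.1 h2, h1⟩
    rw [he] at this
    exact this.elim
  · obtain ⟨θ₀, hθ₀, hmin⟩ := hK.exists_isMinOn hne hcont.continuousOn
    refine ⟨f θ₀, ?_, fun θ h1 h2 => hmin ⟨abs_le.1 h2, h1⟩⟩
    rcases (Finset.sum_nonneg (hnn θ₀)).eq_or_lt with h0 | h0
    · exfalso
      have h1 := (Finset.sum_eq_zero_iff_of_nonneg (hnn θ₀)).1 h0.symm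
      have h2 := cos_gcd B hg θ₀ (abs_le.2 hθ₀.1) (by
        intro j hj
        have h3 := h1 j hj
        have h4 : (0:ℝ) < j := by exact_mod_cast hB j hj
        have h5 : 1 / (q * j) ≠ 0 := by positivity
        have := (mul_eq_zero.1 h3).resolve_left h5
        linarith)
      have h6 : δ ≤ |θ₀| := hθ₀.2
      rw [h2, abs_zero] at h6
      linarith
    · exact h0

noncomputable def sg (B : Finset ℕ) (q x : ℝ) : ℝ := Real.sqrt (∑ j ∈ B, j * x ^ j / q)

lemma dom2 (B : Finset ℕ) (hB : ∀ j ∈ B, 0 < j) (hg : B.gcd id = 1) (D : ℕ) (hD : D ∈ B)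
    (hDm : ∀ j ∈ B, j ≤ D) (q : ℝ) (hq : 0 < q) :
    ∃ K : ℝ, ∀ k x s : ℝ, 1 ≤ x → |s| ≤ Real.pi * sg B q x →
      ‖Complex.exp (EE B q k x (s / sg B q x))‖ ≤ K * (1 + s ^ 2)⁻¹ := by
  have hpi := Real.pi_pos
  have hD0 : (0:ℝ) < D := by exact_mod_cast hB D hD
  obtain ⟨c, hc, hc'⟩ := dom1 B hB hg q (Real.pi / D) hq (by positivity)
  set C : ℝ := ∑ j ∈ B, j / q with hC
  have hCpos : 0 < C := by
    apply Finset.sum_pos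
    · intro j hj
      have : (0:ℝ) < j := by exact_mod_cast hB j hj
      positivity
    · exact ⟨D, hD⟩
  -- c1 : Gaussian constant
  set c1 : ℝ := 1 / (q * D) * (2 / Real.pi ^ 2 * D ^ 2) / C with hc1
  have hc1pos : 0 < c1 := by positivity
  set K2 : ℝ := D.factorial / c ^ D * (1 + Real.pi ^ 2 * C) with hK2
  have hK2pos : 0 < K2 := by positivity
  refine ⟨1 + 1 / c1 + K2, ?_⟩
  intro k x s hx hs
  have hx0 : 0 < x := by linarith
  set σ := sg B q x with hσ
  have hsum_pos : 0 < ∑ j ∈ B, j * x ^ j / q := by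
    apply Finset.sum_pos
    · intro j hj
      have : (0:ℝ) < j := by exact_mod_cast hB j hj
      positivity
    · exact ⟨D, hD⟩
  have hσpos : 0 < σ := Real.sqrt_pos.2 hsum_pos
  have hσ2 : σ ^ 2 = ∑ j ∈ B, j * x ^ j / q := Real.sq_sqrt hsum_pos.le
  have hσle : σ ^ 2 ≤ C * x ^ D := by
    rw [hσ2, hC, Finset.sum_mul]
    apply Finset.sum_le_sum
    intro j hj
    have : x ^ j ≤ x ^ D := pow_le_pow_right₀ hx (hDm j hj)
    calc j * x ^ j / q = j / q * x ^ j := by ring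
      _ ≤ j / q * x ^ D := by gcongr
  have hxD : 1 ≤ x ^ D := one_le_pow₀ hx
  have hnn : ∀ θ, ∀ j ∈ B, 0 ≤ 1 / (q * j) * (1 - Real.cos (j * θ)) := by
    intro θ j _
    have := Real.cos_le_one (j * θ)
    have : 0 ≤ 1 - Real.cos (j * θ) := by linarith
    positivity
  have hnn' : ∀ θ, ∀ j ∈ B, 0 ≤ x ^ j / (q * j) * (1 - Real.cos (j * θ)) := by
    intro θ j _
    have := Real.cos_le_one (j * θ)
    have : 0 ≤ 1 - Real.cos (j * θ) := by linarith
    positivity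
  rw [Complex.norm_exp, EE_re]
  set θ := s / σ with hθ
  have hs1 : 0 < 1 + s ^ 2 := by positivity
  have hθs : |θ| ≤ Real.pi := by
    rw [hθ, abs_div, abs_of_pos hσpos, div_le_iff₀ hσpos]; exact hs
  rcases le_total (|θ|) (Real.pi / D) with hle | hge
  · have hcos : Real.cos (D * θ) ≤ 1 - 2 / Real.pi ^ 2 * (D * θ) ^ 2 := by
      apply Real.cos_le_one_sub_mul_cos_sq
      rw [abs_mul, abs_of_pos hD0]
      rw [le_div_iff₀ hD0] at hle
      linarith
    have h1 : x ^ D / (q * D) * (1 - Real.cos (D * θ))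
        ≤ ∑ j ∈ B, x ^ j / (q * j) * (1 - Real.cos (j * θ)) :=
      Finset.single_le_sum (f := fun j : ℕ => x ^ j / (q * j) * (1 - Real.cos (j * θ))) (hnn' θ) hD
    have h2 : c1 * s ^ 2 ≤ x ^ D / (q * D) * (1 - Real.cos (D * θ)) := by
      have h3 : x ^ D / (q * D) * (2 / Real.pi ^ 2 * (D * θ) ^ 2)
          ≤ x ^ D / (q * D) * (1 - Real.cos (D * θ)) := by
        gcongr; linarith
      refine le_trans ?_ h3
      have h4 : s = θ * σ := by rw [hθ]; field_simp
      have h5 : c1 * s ^ 2 = (1 / (q * D) * (2 / Real.pi ^ 2 * D ^ 2) / C) * θ ^ 2 * σ ^ 2 := by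
        rw [h4, hc1]; ring
      rw [h5]
      calc (1 / (q * D) * (2 / Real.pi ^ 2 * D ^ 2) / C) * θ ^ 2 * σ ^ 2
          ≤ (1 / (q * D) * (2 / Real.pi ^ 2 * D ^ 2) / C) * θ ^ 2 * (C * x ^ D) := by gcongr
        _ = x ^ D / (q * D) * (2 / Real.pi ^ 2 * (D * θ) ^ 2) := by
          field_simp
    have h6 : Real.exp (-∑ j ∈ B, x ^ j / (q * j) * (1 - Real.cos (j * θ))) ≤ (1 + c1 * s ^ 2)⁻¹ := by
      rw [Real.exp_neg]
      apply inv_anti₀ (by positivity)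
      have := Real.add_one_le_exp (∑ j ∈ B, x ^ j / (q * j) * (1 - Real.cos (j * θ)))
      linarith
    refine h6.trans ?_
    rw [← div_eq_mul_inv, inv_eq_one_div, div_le_div_iff₀ (by positivity) hs1]
    have e1 : (1 / c1) * (c1 * s ^ 2) = s ^ 2 := by field_simp
    have e2 : 0 ≤ K2 * (1 + c1 * s ^ 2) := by positivity
    have e3 : 0 ≤ 1 / c1 := by positivity
    have e4 : 0 ≤ c1 * s ^ 2 := by positivity
    nlinarith
  · have h1 := hc' θ hge hθs
    have h2 : c * x ≤ ∑ j ∈ B, x ^ j / (q * j) * (1 - Real.cos (j * θ)) := by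
      calc c * x ≤ (∑ j ∈ B, 1 / (q * j) * (1 - Real.cos (j * θ))) * x := by gcongr
        _ = ∑ j ∈ B, x * (1 / (q * j) * (1 - Real.cos (j * θ))) := by
          rw [Finset.sum_mul]; exact Finset.sum_congr rfl (fun j _ => mul_comm _ _)
        _ ≤ ∑ j ∈ B, x ^ j * (1 / (q * j) * (1 - Real.cos (j * θ))) := by
          apply Finset.sum_le_sum
          intro j hj
          apply mul_le_mul_of_nonneg_right _ (hnn θ j hj)
          exact le_self_pow₀ hx (hB j hj).ne'
        _ = _ := Finset.sum_congr rfl (fun j _ => by ring)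
    have h3 : (c * x) ^ D / D.factorial ≤ Real.exp (c * x) :=
      Real.pow_div_factorial_le_exp _ (by positivity) D
    have h4 : Real.exp (-∑ j ∈ B, x ^ j / (q * j) * (1 - Real.cos (j * θ)))
        ≤ D.factorial / (c ^ D * x ^ D) := by
      calc _ ≤ Real.exp (-(c * x)) := Real.exp_le_exp.2 (by linarith)
        _ = (Real.exp (c * x))⁻¹ := Real.exp_neg _
        _ ≤ ((c * x) ^ D / D.factorial)⁻¹ := inv_anti₀ (by positivity) h3
        _ = _ := by rw [inv_div, mul_pow]
    refine h4.trans ?_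
    have h5 : 1 + s ^ 2 ≤ (1 + Real.pi ^ 2 * C) * x ^ D := by
      have : s ^ 2 ≤ (Real.pi * σ) ^ 2 := sq_le_sq' (by linarith [(abs_le.1 hs).1]) (abs_le.1 hs).2
      have e : Real.pi ^ 2 * σ ^ 2 ≤ Real.pi ^ 2 * (C * x ^ D) := by gcongr
      nlinarith
    have h6 : D.factorial / (c ^ D * x ^ D) ≤ K2 * (1 + s ^ 2)⁻¹ := by
      rw [← div_eq_mul_inv, le_div_iff₀ hs1, hK2]
      calc D.factorial / (c ^ D * x ^ D) * (1 + s ^ 2)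
          ≤ D.factorial / (c ^ D * x ^ D) * ((1 + Real.pi ^ 2 * C) * x ^ D) := by gcongr
        _ = _ := by field_simp
    refine h6.trans ?_
    apply mul_le_mul_of_nonneg_right _ (by positivity)
    have e3 : 0 ≤ 1 / c1 := by positivity
    linarith

lemma expLim (t : ℝ) : Tendsto (fun σ : ℝ => ((σ ^ 2 : ℝ) : ℂ) *
    (Complex.exp (((t / σ : ℝ) : ℂ) * Complex.I) - 1 - ((t / σ : ℝ) : ℂ) * Complex.I)) atTop
    (nhds (((-(t ^ 2) / 2 : ℝ)) : ℂ)) := by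
  rw [tendsto_iff_norm_sub_tendsto_zero]
  have h0 : Tendsto (fun σ : ℝ => |t| ^ 3 / σ) atTop (nhds 0) :=
    tendsto_const_nhds.div_atTop tendsto_id
  refine squeeze_zero' (Eventually.of_forall fun _ => norm_nonneg _) ?_ h0
  filter_upwards [eventually_ge_atTop (|t|), eventually_gt_atTop 0] with σ h1 h2
  set z : ℂ := ((t / σ : ℝ) : ℂ) * Complex.I with hz
  have hnz : ‖z‖ = |t| / σ := by
    rw [hz, norm_mul, Complex.norm_I, mul_one, Complex.norm_real, Real.norm_eq_abs, abs_div,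
      abs_of_pos h2]
  have hz1 : ‖z‖ ≤ 1 := by rw [hnz, div_le_one h2]; exact h1
  have hb := Complex.exp_bound hz1 (n := 3) (by norm_num)
  have e : ((σ ^ 2 : ℝ) : ℂ) * (Complex.exp z - 1 - z) - (((-(t ^ 2) / 2 : ℝ)) : ℂ)
      = ((σ ^ 2 : ℝ) : ℂ) * (Complex.exp z - ∑ m ∈ Finset.range 3, z ^ m / m.factorial) := by
    have hz2 : z ^ 2 = ((-(t ^ 2) / σ ^ 2 : ℝ) : ℂ) := by
      rw [hz, mul_pow, Complex.I_sq]; push_cast; ring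
    have hσ : (σ : ℂ) ≠ 0 := by exact_mod_cast h2.ne'
    simp only [Finset.sum_range_succ, Finset.sum_range_zero, hz2]
    push_cast
    norm_num [Nat.factorial]
    field_simp
    ring
  rw [e, norm_mul, Complex.norm_real, Real.norm_eq_abs, abs_of_pos (by positivity)]
  calc σ ^ 2 * ‖Complex.exp z - ∑ m ∈ Finset.range 3, z ^ m / m.factorial‖
      ≤ σ ^ 2 * (‖z‖ ^ 3 * 1) := by
        gcongr
        refine hb.trans ?_
        gcongr
        norm_num [Nat.factorial]
    _ = |t| ^ 3 / σ := by rw [hnz]; field_simp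

lemma pow_ratio (D j : ℕ) (h : j ≤ D) :
    Tendsto (fun x : ℝ => x ^ j / x ^ D) atTop (nhds (if j = D then 1 else 0)) := by
  split_ifs with he
  · subst he
    apply tendsto_const_nhds.congr'
    filter_upwards [eventually_gt_atTop 0] with x hx
    rw [div_self (by positivity)]
  · have : j < D := lt_of_le_of_ne h he
    exact tendsto_pow_div_pow_atTop_zero this

lemma sg_sq (B : Finset ℕ) (q x : ℝ) (hq : 0 < q) (hx : 0 ≤ x) :
    sg B q x ^ 2 = ∑ j ∈ B, j * x ^ j / q := by
  apply Real.sq_sqrt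
  apply Finset.sum_nonneg
  intro j _
  positivity

lemma sg_ratio (B : Finset ℕ) (D : ℕ) (hD : D ∈ B)
    (hDm : ∀ j ∈ B, j ≤ D) (q : ℝ) (hq : 0 < q) :
    Tendsto (fun x : ℝ => sg B q x ^ 2 / x ^ D) atTop (nhds (D / q)) := by
  have h : Tendsto (fun x : ℝ => ∑ j ∈ B, (j / q) * (x ^ j / x ^ D)) atTop
      (nhds (∑ j ∈ B, ((j:ℝ) / q) * (if j = D then 1 else 0))) := by
    apply tendsto_finsetSum
    intro j hj
    exact (pow_ratio D j (hDm j hj)).const_mul _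
  have e : ∑ j ∈ B, ((j:ℝ) / q) * (if j = D then 1 else 0) = D / q := by
    simp [hD]
  rw [e] at h
  refine h.congr' ?_
  filter_upwards [eventually_gt_atTop 0] with x hx
  rw [sg_sq B q x hq hx.le, Finset.sum_div]
  apply Finset.sum_congr rfl
  intro j _
  ring

lemma P_ratio (B : Finset ℕ) (D : ℕ) (hD : D ∈ B) (hDm : ∀ j ∈ B, j ≤ D) :
    Tendsto (fun x : ℝ => (∑ j ∈ B, x ^ j) / x ^ D) atTop (nhds 1) := by
  have h : Tendsto (fun x : ℝ => ∑ j ∈ B, (x ^ j / x ^ D)) atTop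
      (nhds (∑ j ∈ B, (if j = D then 1 else 0))) := by
    apply tendsto_finsetSum
    intro j hj
    exact (pow_ratio D j (hDm j hj))
  have e : ∑ j ∈ B, (if j = D then (1:ℝ) else 0) = 1 := by
    simp [hD]
  rw [e] at h
  refine h.congr (fun x => ?_)
  rw [Finset.sum_div]

lemma sg_ge (B : Finset ℕ) (hB : ∀ j ∈ B, 0 < j) (D : ℕ) (hD : D ∈ B)
    (q x : ℝ) (hq : 0 < q) (hx : 1 ≤ x) : Real.sqrt (x / q) ≤ sg B q x := by
  apply Real.sqrt_le_sqrt
  have hx0 : 0 < x := by linarith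
  refine le_trans ?_ (Finset.single_le_sum (f := fun j : ℕ => (j:ℝ) * x ^ j / q)
    (fun j _ => by positivity) hD)
  have h1 : (1:ℝ) ≤ D := by exact_mod_cast hB D hD
  have h2 : x ≤ x ^ D := le_self_pow₀ hx (hB D hD).ne'
  show x / q ≤ D * x ^ D / q
  gcongr
  nlinarith

lemma sg_tendsto (B : Finset ℕ) (hB : ∀ j ∈ B, 0 < j) (D : ℕ) (hD : D ∈ B)
    (q : ℝ) (hq : 0 < q) : Tendsto (sg B q) atTop atTop := by
  refine tendsto_atTop_mono' _ ?_ (Real.tendsto_sqrt_atTop.comp (tendsto_id.atTop_div_const hq))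
  filter_upwards [eventually_ge_atTop 1] with x hx
  exact sg_ge B hB D hD q x hq hx

lemma EE_lim (B : Finset ℕ) (hB : ∀ j ∈ B, 0 < j) (D : ℕ) (hD : D ∈ B)
    (hDm : ∀ j ∈ B, j ≤ D) (q : ℝ) (hq : 0 < q) (k s : ℝ) :
    Tendsto (fun x : ℝ => EE B q k x (s / sg B q x)) atTop (nhds ((-(1/2) * s ^ 2 : ℝ) : ℂ)) := by
  have hσ := sg_tendsto B hB D hD q hq
  have hD0 : (0:ℝ) < D := by exact_mod_cast hB D hD
  have hmain : Tendsto (fun x : ℝ => ∑ j ∈ B, ((x ^ j / sg B q x ^ 2 / (q * j) : ℝ) : ℂ) *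
      (((sg B q x ^ 2 : ℝ) : ℂ) * (Complex.exp (((j * s / sg B q x : ℝ) : ℂ) * Complex.I) - 1
        - ((j * s / sg B q x : ℝ) : ℂ) * Complex.I))
      + ((k * s / sg B q x : ℝ) : ℂ) * Complex.I) atTop
      (nhds (∑ j ∈ B, (((if j = D then 1 else 0) / (D / q) / (q * j) : ℝ) : ℂ) *
        ((-((j * s) ^ 2) / 2 : ℝ) : ℂ) + ((0 : ℝ) : ℂ) * Complex.I)) := by
    apply Tendsto.add
    · apply tendsto_finsetSum
      intro j hj
      apply Tendsto.mul
      · apply (Complex.continuous_ofReal.tendsto _).comp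
        apply Tendsto.div_const
        have := (pow_ratio D j (hDm j hj)).div (sg_ratio B D hD hDm q hq) (by positivity)
        refine this.congr' ?_
        filter_upwards [eventually_gt_atTop 0] with x hx
        simp only [Pi.div_apply]
        rw [div_div_div_cancel_right₀ (pow_pos hx D).ne']
      · exact (expLim (j * s)).comp hσ
    · apply Tendsto.mul_const
      apply (Complex.continuous_ofReal.tendsto _).comp
      exact tendsto_const_nhds.div_atTop hσ
  have e : (∑ j ∈ B, (((if j = D then 1 else 0) / (D / q) / (q * j) : ℝ) : ℂ) *
        ((-((j * s) ^ 2) / 2 : ℝ) : ℂ) + ((0 : ℝ) : ℂ) * Complex.I) = ((-(1/2) * s ^ 2 : ℝ) : ℂ) := by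
    rw [Finset.sum_eq_single D]
    · rw [if_pos rfl, Complex.ofReal_zero, zero_mul, add_zero, ← Complex.ofReal_mul]
      congr 1
      field_simp
    · intro j _ hj
      simp [hj]
    · intro h; exact absurd hD h
  rw [e] at hmain
  refine hmain.congr' ?_
  filter_upwards [eventually_gt_atTop 0, hσ.eventually_gt_atTop 0] with x hx hσx
  unfold EE
  rw [Qc_polar, Qc_real]
  have hσc : ((sg B q x : ℝ) : ℂ) ≠ 0 := by exact_mod_cast hσx.ne'
  have hqc : (q : ℂ) ≠ 0 := by exact_mod_cast hq.ne'
  have e2 : (((∑ j ∈ B, x ^ j) / q - k : ℝ) : ℂ) * ((s / sg B q x : ℝ) : ℂ) * Complex.I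
      = ∑ j ∈ B, ((x ^ j / (q * j) : ℝ) : ℂ) * (((j * s / sg B q x : ℝ) : ℂ) * Complex.I)
        - ((k * s / sg B q x : ℝ) : ℂ) * Complex.I := by
    have : ((∑ j ∈ B, x ^ j) / q : ℝ) = ∑ j ∈ B, (x ^ j / (q * j) * j) := by
      rw [Finset.sum_div]
      apply Finset.sum_congr rfl
      intro j hj
      have : (0:ℝ) < j := by exact_mod_cast hB j hj
      field_simp
    rw [this]
    push_cast
    rw [sub_mul, sub_mul, Finset.sum_mul, Finset.sum_mul]
    congr 1
    · apply Finset.sum_congr rfl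
      intro j _
      ring
    · ring
  rw [e2, Complex.ofReal_sum, ← Finset.sum_sub_distrib, sub_sub_eq_add_sub, add_sub_right_comm,
    ← Finset.sum_sub_distrib]
  congr 1
  apply Finset.sum_congr rfl
  intro j _
  have e3 : ((x ^ j / sg B q x ^ 2 / (q * j) : ℝ) : ℂ) * ((sg B q x ^ 2 : ℝ) : ℂ)
      = ((x ^ j / (q * j) : ℝ) : ℂ) := by
    rw [← Complex.ofReal_mul]
    congr 1
    field_simp
  rw [← mul_assoc, e3, mul_div_assoc]
  ring

lemma gauss_lim (B : Finset ℕ) (hB : ∀ j ∈ B, 0 < j) (hg : B.gcd id = 1) (D : ℕ) (hD : D ∈ B)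
    (hDm : ∀ j ∈ B, j ≤ D) (q : ℝ) (hq : 0 < q) (k : ℝ) :
    Tendsto (fun x : ℝ => ∫ s : ℝ in (-(Real.pi * sg B q x))..(Real.pi * sg B q x),
      Complex.exp (EE B q k x (s / sg B q x))) atTop
      (nhds ((Real.sqrt (Real.pi / (1/2)) : ℝ) : ℂ)) := by
  have hσ := sg_tendsto B hB D hD q hq
  obtain ⟨K, hK⟩ := dom2 B hB hg D hD hDm q hq
  have hK0 : 0 ≤ K := by
    have := hK 0 1 0 le_rfl (by
      rw [abs_zero]; exact mul_nonneg Real.pi_pos.le (Real.sqrt_nonneg _))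
    have h2 := norm_nonneg (Complex.exp (EE B q 0 1 (0 / sg B q 1)))
    simp only [ne_eq, OfNat.ofNat_ne_zero, not_false_eq_true, zero_pow, add_zero, inv_one, mul_one] at this
    linarith
  have hlim : Tendsto (fun x : ℝ => ∫ s : ℝ,
      (Set.Ioc (-(Real.pi * sg B q x)) (Real.pi * sg B q x)).indicator
      (fun s => Complex.exp (EE B q k x (s / sg B q x))) s) atTop
      (nhds (∫ s : ℝ, ((Real.exp (-(1/2) * s ^ 2) : ℝ) : ℂ))) := by
    apply MeasureTheory.tendsto_integral_filter_of_dominated_convergence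
      (fun s : ℝ => K * (1 + s ^ 2)⁻¹)
    · refine Eventually.of_forall fun x => ?_
      apply MeasureTheory.AEStronglyMeasurable.indicator _ measurableSet_Ioc
      apply Continuous.aestronglyMeasurable
      unfold EE Qc
      fun_prop
    · filter_upwards [eventually_ge_atTop 1] with x hx
      refine Eventually.of_forall fun s => ?_
      by_cases hs : s ∈ Set.Ioc (-(Real.pi * sg B q x)) (Real.pi * sg B q x)
      · rw [Set.indicator_of_mem hs]
        exact hK k x s hx (abs_le.2 ⟨hs.1.le, hs.2⟩)
      · rw [Set.indicator_of_notMem hs, norm_zero]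
        positivity
    · exact integrable_inv_one_add_sq.const_mul K
    · refine Eventually.of_forall fun s => ?_
      have h1 := (Complex.continuous_exp.tendsto _).comp (EE_lim B hB D hD hDm q hq k s)
      rw [← Complex.ofReal_exp] at h1
      refine h1.congr' ?_
      filter_upwards [hσ.eventually_gt_atTop (|s| / Real.pi)] with x hx
      rw [div_lt_iff₀ Real.pi_pos] at hx
      rw [Set.indicator_of_mem]
      · rfl
      · have := abs_lt.1 (show |s| < Real.pi * sg B q x by linarith)
        exact ⟨this.1, this.2.le⟩
  rw [integral_complex_ofReal, integral_gaussian] at hlim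
  refine hlim.congr (fun x => ?_)
  rw [MeasureTheory.integral_indicator measurableSet_Ioc, intervalIntegral.integral_of_le]
  have := mul_nonneg Real.pi_pos.le (Real.sqrt_nonneg (∑ j ∈ B, j * x ^ j / q))
  unfold sg
  linarith

lemma int_eq (B : Finset ℕ) (hB : ∀ j ∈ B, 0 < j) (q x : ℝ) (hq : 0 < q) (hx : 0 < x)
    (hσ : 0 < sg B q x)
    (b : ℕ → ℝ) (hb0 : b 0 = 1)
    (hb : ∀ m : ℕ, q * m * b m = ∑ j ∈ B.filter (· ≤ m), b (m - j)) (m k : ℕ) (hk : k ≤ m)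
    (hxm : ∑ j ∈ B, x ^ j = q * m) :
    ∫ s : ℝ in (-(Real.pi * sg B q x))..(Real.pi * sg B q x),
      Complex.exp (EE B q k x (s / sg B q x))
      = ((sg B q x * (Real.exp (-∑ j ∈ B, x ^ j / (q * j)) * (2 * Real.pi * b (m - k) * x ^ (m - k))) : ℝ) : ℂ) := by
  have h1 := intervalIntegral.integral_comp_div (a := -(Real.pi * sg B q x)) (b := Real.pi * sg B q x)
    (fun θ : ℝ => Complex.exp (EE B q k x θ)) hσ.ne'
  rw [h1, ← neg_div', mul_div_cancel_right₀ _ hσ.ne']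
  have h2 : ∀ θ : ℝ, Complex.exp (EE B q k x θ) = Complex.exp (-Qc B q x) *
      Complex.exp (Qc B q (x * Complex.exp (θ * Complex.I)) - (m - k : ℕ) * θ * Complex.I) := by
    intro θ
    rw [← Complex.exp_add]
    congr 1
    unfold EE
    rw [hxm, mul_div_cancel_left₀ _ hq.ne']
    push_cast [Nat.cast_sub hk]
    ring
  simp_rw [h2]
  rw [intervalIntegral.integral_const_mul, coef_int B hB q x hq hx b hb0 hb (m - k), Qc_real,
    Complex.real_smul]
  push_cast
  ring

lemma saddle_exists (B : Finset ℕ) (hB : ∀ j ∈ B, 0 < j) (D : ℕ) (hD : D ∈ B)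
    (y : ℝ) (hy : 0 ≤ y) : ∃ x : ℝ, 0 ≤ x ∧ ∑ j ∈ B, x ^ j = y := by
  have hc : ContinuousOn (fun x : ℝ => ∑ j ∈ B, x ^ j) (Set.Icc 0 (1 + y)) := by fun_prop
  have h := intermediate_value_Icc (by linarith : (0:ℝ) ≤ 1 + y) hc
  have h0 : ∑ j ∈ B, (0:ℝ) ^ j = 0 :=
    Finset.sum_eq_zero (fun j hj => by simp [(hB j hj).ne'])
  have h1 : y ≤ ∑ j ∈ B, (1 + y) ^ j := by
    refine le_trans ?_ (Finset.single_le_sum (f := fun j : ℕ => (1 + y) ^ j)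
      (fun j _ => by positivity) hD)
    have : 1 + y ≤ (1 + y) ^ D := le_self_pow₀ (by linarith) (hB D hD).ne'
    show y ≤ (1 + y) ^ D
    linarith
  obtain ⟨x, hx, hxy⟩ := h ⟨by simpa [h0] using hy, h1⟩
  exact ⟨x, hx.1, hxy⟩

lemma analytic_main (B : Finset ℕ) (hB : ∀ j ∈ B, 0 < j) (hg : B.gcd id = 1) (D : ℕ) (hD : D ∈ B)
    (hDm : ∀ j ∈ B, j ≤ D) (q : ℝ) (hq : 0 < q)
    (b : ℕ → ℝ) (hb0 : b 0 = 1)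
    (hb : ∀ m : ℕ, q * m * b m = ∑ j ∈ B.filter (· ≤ m), b (m - j)) :
    Tendsto (fun m : ℕ => b (m - 1) / b m / (q * m) ^ ((1:ℝ) / D)) atTop (nhds 1) := by
  have hD0 : (0:ℝ) < D := by exact_mod_cast hB D hD
  choose x hx0 hxm using fun m : ℕ => saddle_exists B hB D hD (q * m) (by positivity)
  have hyT : Tendsto (fun m : ℕ => q * (m:ℝ)) atTop atTop :=
    tendsto_natCast_atTop_atTop.const_mul_atTop hq
  have hxT : Tendsto x atTop atTop := by
    rw [tendsto_atTop]
    intro R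
    filter_upwards [hyT.eventually_gt_atTop (∑ j ∈ B, (max R 0) ^ j)] with m hm
    by_contra hcon
    push Not at hcon
    rw [← hxm m] at hm
    apply absurd hm
    push Not
    apply Finset.sum_le_sum
    intro j _
    exact pow_le_pow_left₀ (hx0 m) (hcon.le.trans (le_max_left _ _)) _
  have hx_ratio : Tendsto (fun m : ℕ => x m / (q * m) ^ ((1:ℝ) / D)) atTop (nhds 1) := by
    have h1 := (P_ratio B D hD hDm).comp hxT
    have h2 := (h1.inv₀ one_ne_zero).rpow_const (p := (1:ℝ) / D) (Or.inr (by positivity))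
    rw [inv_one, Real.one_rpow] at h2
    refine h2.congr' ?_
    filter_upwards [hxT.eventually_gt_atTop 0, eventually_gt_atTop 0] with m hm hm0
    simp only [Function.comp]
    rw [hxm m, inv_div, Real.div_rpow (by positivity) (by positivity), ← Real.rpow_natCast,
      ← Real.rpow_mul hm.le, mul_one_div_cancel hD0.ne', Real.rpow_one]
  have hsp : (0:ℝ) < Real.sqrt (Real.pi / (1/2)) := Real.sqrt_pos.2 (by positivity)
  have lim : ∀ k : ℕ, Tendsto (fun m : ℕ => sg B q (x m) * (Real.exp (-∑ j ∈ B, (x m) ^ j / (q * j)) *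
      (2 * Real.pi * b (m - k) * (x m) ^ (m - k)))) atTop (nhds (Real.sqrt (Real.pi / (1/2)))) := by
    intro k
    have h1 := (gauss_lim B hB hg D hD hDm q hq k).comp hxT
    have h2 := (Complex.continuous_re.tendsto _).comp h1
    rw [Complex.ofReal_re] at h2
    refine h2.congr' ?_
    filter_upwards [hxT.eventually_gt_atTop 0, eventually_ge_atTop k,
      ((sg_tendsto B hB D hD q hq).comp hxT).eventually_gt_atTop 0] with m h3 h4 h5
    simp only [Function.comp]
    rw [int_eq B hB q (x m) hq h3 h5 b hb0 hb m k h4 (hxm m), Complex.ofReal_re]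
  have h3 := ((lim 1).div (lim 0) hsp.ne').mul hx_ratio
  rw [div_self hsp.ne', one_mul] at h3
  refine h3.congr' ?_
  filter_upwards [hxT.eventually_gt_atTop 0, eventually_ge_atTop 1,
      ((sg_tendsto B hB D hD q hq).comp hxT).eventually_gt_atTop 0] with m h3 h4 h5
  simp only [Function.comp] at h5
  simp only [Pi.div_apply, Nat.sub_zero]
  have h6 : x m ^ m = x m ^ (m - 1) * x m := by
    rw [← pow_succ]; congr 1; omega
  rw [h6]
  have := Real.exp_pos (-∑ j ∈ B, (x m) ^ j / (q * j))
  generalize Real.exp (-∑ j ∈ B, (x m) ^ j / (q * j)) = e at *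
  have hpi := Real.pi_pos
  by_cases hbm : b m = 0
  · simp [hbm]
  · field_simp

theorem stmt_10 (A : Finset ℕ) (hA : A.Nonempty) (hApos : ∀ a ∈ A, 0 < a)
    (d p : ℕ) (hd : d = A.max' hA) (hp : p = A.gcd id) :
    Tendsto (fun n : ℕ =>
        (((permCount ↑A (n - p) : ℝ) / (n - p).factorial) /
          ((permCount ↑A n : ℝ) / n.factorial)) / (n : ℝ) ^ ((p : ℝ) / d))
      (atTop ⊓ Filter.principal {n | p ∣ n}) (nhds 1) := by
  have hdA : d ∈ A := hd ▸ A.max'_mem hA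
  have hdmax : ∀ a ∈ A, a ≤ d := fun a ha => hd ▸ A.le_max' a ha
  have hd0 : 0 < d := hApos d hdA
  have hpdvd : ∀ a ∈ A, p ∣ a := fun a ha => hp ▸ Finset.gcd_dvd (f := id) ha
  have hp0 : 0 < p := Nat.pos_of_dvd_of_pos (hpdvd d hdA) hd0
  have hpR : (0:ℝ) < p := by exact_mod_cast hp0
  set B := A.image (· / p) with hBdef
  have hmem : ∀ j, j ∈ B ↔ p * j ∈ A := by
    intro j
    rw [hBdef, Finset.mem_image]
    constructor
    · rintro ⟨a, ha, rfl⟩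
      rwa [Nat.mul_div_cancel' (hpdvd a ha)]
    · intro h
      exact ⟨p * j, h, Nat.mul_div_cancel_left _ hp0⟩
  obtain ⟨D, hD⟩ := hpdvd d hdA
  have hB : ∀ j ∈ B, 0 < j := by
    intro j hj
    exact Nat.pos_of_mul_pos_left (hApos _ ((hmem j).1 hj))
  have hDB : D ∈ B := (hmem D).2 (hD ▸ hdA)
  have hDm : ∀ j ∈ B, j ≤ D := by
    intro j hj
    have := hdmax _ ((hmem j).1 hj)
    rw [hD] at this
    exact Nat.le_of_mul_le_mul_left this hp0
  have hg : B.gcd id = 1 := by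
    rw [hBdef, Finset.gcd_image]
    have := Finset.gcd_div_id_eq_one hdA hd0.ne'
    rw [← hp] at this
    exact this
  set b : ℕ → ℝ := fun m => (permCount ↑A (p * m) : ℝ) / (p * m).factorial with hbdef
  have hb0 : b 0 = 1 := permCount_zero A
  have hb : ∀ m : ℕ, (p:ℝ) * m * b m = ∑ j ∈ B.filter (· ≤ m), b (m - j) := by
    intro m
    have h := permCount_rec A hApos (p * m)
    push_cast at h
    rw [hbdef]
    simp only
    rw [h]
    symm
    apply Finset.sum_bij (fun j _ => p * j)
    · intro j hj
      rw [Finset.mem_filter] at hj ⊢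
      exact ⟨(hmem j).1 hj.1, Nat.mul_le_mul_left p hj.2⟩
    · intro j _ i _ hij
      exact Nat.eq_of_mul_eq_mul_left hp0 hij
    · intro a ha
      rw [Finset.mem_filter] at ha
      obtain ⟨j, rfl⟩ := hpdvd a ha.1
      refine ⟨j, ?_, rfl⟩
      rw [Finset.mem_filter]
      exact ⟨(hmem j).2 ha.1, Nat.le_of_mul_le_mul_left ha.2 hp0⟩
    · intro j _
      rw [Nat.mul_sub]
  have hmain := analytic_main B hB hg D hDB hDm p hpR b hb0 hb
  have hdiv : Tendsto (fun n : ℕ => n / p) (atTop ⊓ Filter.principal {n | p ∣ n}) atTop :=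
    (Nat.tendsto_div_const_atTop hp0.ne').mono_left inf_le_left
  refine (hmain.comp hdiv).congr' ?_
  have hev : ∀ᶠ n in (atTop ⊓ Filter.principal {n | p ∣ n}), p ∣ n :=
    (Filter.mem_inf_of_right (Filter.mem_principal_self _))
  filter_upwards [hev] with n hn
  obtain ⟨m, rfl⟩ := hn
  simp only [Function.comp, hbdef]
  rw [Nat.mul_div_cancel_left _ hp0]
  have e1 : p * m - p = p * (m - 1) := by rw [Nat.mul_sub, mul_one]
  have e2 : (p:ℝ) / d = 1 / D := by
    rw [hD]
    push_cast
    rw [div_mul_eq_div_div, div_self hpR.ne']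
  rw [e1, e2]
  push_cast
  rfl
end

section
/- Let A be a set of positive integers with gcd q such that u_n := |S_{qn}^{(A)}|/(qn)! satisfies u_n/u_{n-1} → 1. Let σ_n be uniform on S_{qn}^{(A)}, and for a permutation τ let N_k(τ) be the number of k-cycles of τ. Then for every finite subset K of A, the joint law of (N_k(σ_n))_{k∈K} converges weakly, as n → ∞, to the product of Poisson distributions ⊗_{k∈K} Poisson(1/k). -/
open Filter

/-- The number of cycles of length `k` of a permutation (fixed points count as `1`-cycles):
the number of points whose cycle has length `k`, divided by `k`. -/
noncomputable def cycleCount {n : ℕ} (σ : Equiv.Perm (Fin n)) (k : ℕ) : ℕ :=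
  Nat.card {x : Fin n // Function.minimalPeriod ⇑σ x = k} / k


noncomputable section
open Finset

/-- Multisets of positive integers summing to `n`. -/
def PN (n : ℕ) : Finset (Multiset ℕ) := (Finset.univ : Finset (Nat.Partition n)).image (fun p => p.parts)

lemma mem_PN {n : ℕ} {m : Multiset ℕ} : m ∈ PN n ↔ m.sum = n ∧ ∀ i ∈ m, 0 < i := by
  unfold PN
  simp only [Finset.mem_image, Finset.mem_univ, true_and]
  constructor
  · rintro ⟨p, rfl⟩
    exact ⟨p.parts_sum, fun i hi => p.parts_pos hi⟩
  · rintro ⟨h1, h2⟩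
    exact ⟨⟨m, fun {i} hi => h2 i hi, h1⟩, rfl⟩

def wt (m : Multiset ℕ) : ℝ := ((m.prod : ℝ) * ∏ k ∈ m.toFinset, ((m.count k).factorial : ℝ))⁻¹

def ct {n : ℕ} (σ : Equiv.Perm (Fin n)) : Multiset ℕ := σ.partition.parts

lemma ct_eq {n : ℕ} (σ : Equiv.Perm (Fin n)) :
    ct σ = σ.cycleType + Multiset.replicate (n - σ.support.card) 1 := by
  unfold ct
  rw [Equiv.Perm.parts_partition]; simp

lemma ct_mem {n : ℕ} (σ : Equiv.Perm (Fin n)) : ct σ ∈ PN n := by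
  rw [mem_PN]
  refine ⟨?_, fun i hi => σ.partition.parts_pos hi⟩
  have := σ.partition.parts_sum
  unfold ct; rw [this]; simp

lemma decomp {n : ℕ} {m : Multiset ℕ} (hm : m ∈ PN n) :
    m = m.filter (2 ≤ ·) + Multiset.replicate (m.count 1) 1 := by
  rw [mem_PN] at hm
  ext a
  rw [Multiset.count_add, Multiset.count_filter, Multiset.count_replicate]
  by_cases h0 : a = 0
  · subst h0
    have : (0:ℕ) ∉ m := fun h => by have := hm.2 0 h; omega
    simp [this]
  by_cases h1 : a = 1
  · subst h1; simp
  · have : 2 ≤ a := by omega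
    simp [this, Ne.symm h1]

lemma ct_filter {n : ℕ} (σ : Equiv.Perm (Fin n)) : (ct σ).filter (2 ≤ ·) = σ.cycleType := by
  unfold ct; exact Equiv.Perm.filter_parts_partition_eq_cycleType

lemma ct_eq_iff {n : ℕ} (σ : Equiv.Perm (Fin n)) {m : Multiset ℕ} (hm : m ∈ PN n) :
    ct σ = m ↔ σ.cycleType = m.filter (2 ≤ ·) := by
  constructor
  · rintro rfl; rw [ct_filter]
  · intro h
    have h1 := decomp hm
    have h2 := decomp (ct_mem σ)
    rw [ct_filter, h] at h2
    have h3 : m.sum = (ct σ).sum := by rw [(mem_PN.1 hm).1, (mem_PN.1 (ct_mem σ)).1]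
    rw [h1, h2] at h3
    simp only [Multiset.sum_add, Multiset.sum_replicate, smul_eq_mul, mul_one] at h3
    have h4 : m.count 1 = (ct σ).count 1 := by
      simpa [Multiset.count_add, Multiset.count_filter] using h3
    rw [h1, h2, h4]

lemma card_ct {n : ℕ} {m : Multiset ℕ} (hm : m ∈ PN n) :
    ((#{σ : Equiv.Perm (Fin n) | ct σ = m} : ℕ) : ℝ) = n.factorial * wt m := by
  have h := Equiv.Perm.card_of_cycleType_mul_eq (Fin n) (m.filter (2 ≤ ·))
  have h1 := decomp hm
  have hs := (mem_PN.1 hm).1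
  have hpos := (mem_PN.1 hm).2
  have hsum : (m.filter (2 ≤ ·)).sum + m.count 1 = n := by
    conv_rhs => rw [← hs, h1]
    simp
  rw [if_pos ⟨by simp; omega, by simp⟩] at h
  have hprod : (m.filter (2 ≤ ·)).prod = m.prod := by
    conv_rhs => rw [h1]
    simp
  have hne : m.prod ≠ 0 := by
    rw [Ne, Multiset.prod_eq_zero_iff]
    intro h0; have := hpos 0 h0; omega
  have hp2 : ∏ k ∈ m.toFinset, (m.count k).factorial =
      (m.count 1).factorial * ∏ k ∈ (m.filter (2 ≤ ·)).toFinset, ((m.filter (2 ≤ ·)).count k).factorial := by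
    have e1 : ∏ k ∈ m.toFinset, (m.count k).factorial = ∏ k ∈ insert 1 m.toFinset, (m.count k).factorial := by
      apply Finset.prod_subset (Finset.subset_insert _ _)
      intro x _ hx
      rw [Multiset.mem_toFinset] at hx
      simp [Multiset.count_eq_zero_of_notMem hx]
    have e2 : insert 1 m.toFinset = insert 1 (m.filter (2 ≤ ·)).toFinset := by
      ext a
      simp only [Finset.mem_insert, Multiset.mem_toFinset, Multiset.mem_filter]
      constructor
      · rintro (h | h)
        · exact Or.inl h
        · have := hpos a h
          by_cases h' : a = 1
          · exact Or.inl h'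
          · exact Or.inr ⟨h, by omega⟩
      · rintro (h | h)
        · exact Or.inl h
        · exact Or.inr h.1
    rw [e1, e2, Finset.prod_insert (by simp)]
    congr 1
    apply Finset.prod_congr rfl
    intro x hx
    rw [Multiset.mem_toFinset, Multiset.mem_filter] at hx
    rw [Multiset.count_filter, if_pos hx.2]
  have hc : Fintype.card (Fin n) - (m.filter (2 ≤ ·)).sum = m.count 1 := by simp; omega
  rw [hc, hprod, Fintype.card_fin] at h
  have hset : #{σ : Equiv.Perm (Fin n) | ct σ = m} =
      #{σ : Equiv.Perm (Fin n) | σ.cycleType = m.filter (2 ≤ ·)} := by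
    congr 1
    ext σ
    simp [ct_eq_iff σ hm]
  rw [hset]
  have hden : (m.prod : ℝ) * ∏ k ∈ m.toFinset, ((m.count k).factorial : ℝ) ≠ 0 := by
    apply mul_ne_zero (by exact_mod_cast hne)
    apply Finset.prod_ne_zero_iff.2
    intro a _
    exact_mod_cast Nat.factorial_ne_zero _
  unfold wt
  rw [eq_mul_inv_iff_mul_eq₀ hden, ← h]
  have := hp2
  push_cast
  rw [← Nat.cast_prod, hp2]
  push_cast
  ring

lemma card_pred {n : ℕ} (Q : Multiset ℕ → Prop) [DecidablePred Q] :
    (Nat.card {σ : Equiv.Perm (Fin n) // Q (ct σ)} : ℝ) =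
      n.factorial * ∑ m ∈ PN n with Q m, wt m := by
  classical
  rw [Nat.card_eq_fintype_card, Fintype.card_subtype,
    Finset.card_eq_sum_card_fiberwise (f := ct) (t := {m ∈ PN n | Q m}), Finset.mul_sum]
  · push_cast
    apply Finset.sum_congr rfl
    intro m hm
    rw [Finset.mem_filter] at hm
    rw [← card_ct hm.1]
    congr 2
    ext σ
    simp only [Finset.mem_filter, Finset.mem_univ, true_and]
    constructor
    · exact fun h => h.2
    · intro h; exact ⟨h ▸ hm.2, h⟩
  · intro σ hσ
    have : Q (ct σ) := by simpa using hσ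
    simp [ct_mem, this]

lemma minPer_supp {n : ℕ} (σ : Equiv.Perm (Fin n)) {x : Fin n} (hx : x ∈ σ.support) :
    Function.minimalPeriod ⇑σ x = (σ.cycleOf x).support.card := by
  have h := Equiv.Perm.isCycleOn_support_cycleOf σ x
  have hx' : x ∈ (σ.cycleOf x).support := by
    rw [Equiv.Perm.mem_support_cycleOf_iff]
    exact ⟨Equiv.Perm.SameCycle.refl _ _, hx⟩
  apply Nat.dvd_antisymm
  · rw [← Function.isPeriodicPt_iff_minimalPeriod_dvd]
    have := (h.pow_apply_eq hx' (n := (σ.cycleOf x).support.card)).2 dvd_rfl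
    rw [Function.IsPeriodicPt, Function.IsFixedPt, Equiv.Perm.iterate_eq_pow]
    exact this
  · rw [← h.pow_apply_eq hx', ← Equiv.Perm.iterate_eq_pow]
    exact Function.iterate_minimalPeriod

lemma card_minPer {n : ℕ} (σ : Equiv.Perm (Fin n)) (k : ℕ) :
    #{x : Fin n | Function.minimalPeriod ⇑σ x = k} = k * (ct σ).count k := by
  classical
  by_cases h0 : k = 0
  · subst h0
    rw [zero_mul, Finset.card_eq_zero, Finset.filter_eq_empty_iff]
    intro x _
    have : 0 < Function.minimalPeriod ⇑σ x :=
      Function.minimalPeriod_pos_of_mem_periodicPts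
        (σ.injective.mem_periodicPts x)
    omega
  by_cases h1 : k = 1
  · subst h1
    rw [ct_eq, Multiset.count_add, Multiset.count_replicate]
    have : Multiset.count 1 σ.cycleType = 0 := by
      apply Multiset.count_eq_zero_of_notMem
      intro h; have := Equiv.Perm.two_le_of_mem_cycleType h; omega
    rw [this]
    simp only [if_true, zero_add, one_mul]
    have e : ({x : Fin n | Function.minimalPeriod ⇑σ x = 1} : Finset (Fin n)) = σ.supportᶜ := by
      ext x
      simp [Function.minimalPeriod_eq_one_iff_isFixedPt, Function.IsFixedPt]
    rw [e, Finset.card_compl, Fintype.card_fin]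
  · have hc : (ct σ).count k = σ.cycleType.count k := by
      rw [ct_eq, Multiset.count_add, Multiset.count_replicate, if_neg (Ne.symm h1), add_zero]
    rw [hc, Equiv.Perm.cycleType_def, Multiset.count_map]
    have e : ({x : Fin n | Function.minimalPeriod ⇑σ x = k} : Finset (Fin n)) =
        ({c ∈ σ.cycleFactorsFinset | k = c.support.card}).biUnion (fun c => c.support) := by
      ext x
      simp only [Finset.mem_filter, Finset.mem_univ, true_and, Finset.mem_biUnion]
      constructor
      · intro h
        have hx : x ∈ σ.support := by
          rw [Equiv.Perm.mem_support]
          intro hf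
          have := Function.minimalPeriod_eq_one_iff_isFixedPt.2 (show Function.IsFixedPt σ x from hf)
          omega
        refine ⟨σ.cycleOf x, ⟨Equiv.Perm.cycleOf_mem_cycleFactorsFinset_iff.2 hx, ?_⟩, ?_⟩
        · rw [← minPer_supp σ hx, h]
        · rw [Equiv.Perm.mem_support_cycleOf_iff]
          exact ⟨Equiv.Perm.SameCycle.refl _ _, hx⟩
      · rintro ⟨c, ⟨hc, hk⟩, hx⟩
        have hx' := Equiv.Perm.mem_cycleFactorsFinset_support_le hc hx
        rw [minPer_supp σ hx', ← Equiv.Perm.cycle_is_cycleOf hx hc, hk]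
    rw [e, Finset.card_biUnion]
    · rw [Finset.sum_congr rfl (g := fun _ => k)]
      · rw [Finset.sum_const, smul_eq_mul, mul_comm]
        rfl
      · intro c hc
        exact (Finset.mem_filter.1 hc).2.symm
    · intro c hc d hd hne
      exact (Equiv.Perm.cycleFactorsFinset_pairwise_disjoint σ (Finset.mem_filter.1 hc).1
        (Finset.mem_filter.1 hd).1 hne).disjoint_support

lemma cycleCount_eq {n : ℕ} (σ : Equiv.Perm (Fin n)) (k : ℕ) : cycleCount σ k = (ct σ).count k := by
  unfold cycleCount
  rw [Nat.card_eq_fintype_card, Fintype.card_subtype, card_minPer]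
  by_cases h : k = 0
  · subst h
    have : (0:ℕ) ∉ ct σ := fun h => by have := (mem_PN.1 (ct_mem σ)).2 0 h; omega
    simp [this]
  · rw [Nat.mul_div_cancel_left _ (Nat.pos_of_ne_zero h)]

lemma minPer_mem {n : ℕ} (σ : Equiv.Perm (Fin n)) (A : Set ℕ) :
    (∀ x, Function.minimalPeriod ⇑σ x ∈ A) ↔ ∀ k ∈ ct σ, k ∈ A := by
  have key : ∀ k, k ∈ ct σ ↔ ∃ x, Function.minimalPeriod ⇑σ x = k := by
    intro k
    have h := card_minPer σ k
    constructor
    · intro hk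
      have hk0 := (mem_PN.1 (ct_mem σ)).2 k hk
      have h2 := Multiset.count_pos.2 hk
      have : 0 < #{x : Fin n | Function.minimalPeriod ⇑σ x = k} := by rw [h]; positivity
      obtain ⟨x, hx⟩ := Finset.card_pos.1 this
      exact ⟨x, by simpa using hx⟩
    · rintro ⟨x, hx⟩
      have : 0 < #{x : Fin n | Function.minimalPeriod ⇑σ x = k} :=
        Finset.card_pos.2 ⟨x, by simpa using hx⟩
      rw [h] at this
      exact Multiset.count_pos.1 (Nat.pos_of_mul_pos_left this)
  constructor
  · intro h k hk
    obtain ⟨x, rfl⟩ := (key k).1 hk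
    exact h x
  · intro h x
    exact h _ ((key _).2 ⟨x, rfl⟩)

open Classical in
def aa (A : Set ℕ) (n : ℕ) : ℝ := ∑ m ∈ PN n with (∀ k ∈ m, k ∈ A), wt m

open Classical in
def pp (A : Set ℕ) (K : Finset ℕ) (r : ℕ → ℕ) (n : ℕ) : ℝ :=
  ∑ m ∈ PN n with ((∀ k ∈ m, k ∈ A) ∧ ∀ k ∈ K, m.count k = r k), wt m

def RR (K : Finset ℕ) (r : ℕ → ℕ) : Multiset ℕ := ∑ k ∈ K, Multiset.replicate (r k) k

lemma count_RR (K : Finset ℕ) (r : ℕ → ℕ) (a : ℕ) :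
    (RR K r).count a = if a ∈ K then r a else 0 := by
  unfold RR
  rw [Multiset.count_sum']
  simp [Multiset.count_replicate]

lemma sum_RR (K : Finset ℕ) (r : ℕ → ℕ) : (RR K r).sum = ∑ k ∈ K, k * r k := by
  unfold RR
  rw [Multiset.sum_sum]
  simp [mul_comm]

lemma prod_RR (K : Finset ℕ) (r : ℕ → ℕ) : (RR K r).prod = ∏ k ∈ K, k ^ r k := by
  unfold RR
  rw [Multiset.prod_sum]
  simp

lemma mem_RR {K : Finset ℕ} {r : ℕ → ℕ} {a : ℕ} (h : a ∈ RR K r) : a ∈ K := by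
  by_contra hn
  have := Multiset.count_pos.2 h
  rw [count_RR, if_neg hn] at this
  omega

lemma wt_RR (K : Finset ℕ) (r : ℕ → ℕ) :
    wt (RR K r) = ∏ k ∈ K, (1 / (k : ℝ)) ^ (r k) / (r k).factorial := by
  unfold wt
  have e : ∏ k ∈ (RR K r).toFinset, (((RR K r).count k).factorial : ℝ) =
      ∏ k ∈ K, ((r k).factorial : ℝ) := by
    rw [Finset.prod_subset (s₂ := K)]
    · apply Finset.prod_congr rfl
      intro k hk
      rw [count_RR, if_pos hk]
    · intro a ha
      exact mem_RR (Multiset.mem_toFinset.1 ha)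
    · intro a _ ha
      rw [Multiset.mem_toFinset] at ha
      simp [Multiset.count_eq_zero_of_notMem ha]
  rw [e, prod_RR]
  push_cast
  rw [← Finset.prod_mul_distrib, ← Finset.prod_inv_distrib]
  apply Finset.prod_congr rfl
  intro k _
  rw [mul_inv, div_eq_mul_inv, one_div, inv_pow]

lemma wt_add {a b : Multiset ℕ} (h : Disjoint a.toFinset b.toFinset) :
    wt (a + b) = wt a * wt b := by
  unfold wt
  rw [Multiset.toFinset_add, Finset.prod_union h, Multiset.prod_add]
  have e1 : ∏ k ∈ a.toFinset, (((a + b).count k).factorial : ℝ) =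
      ∏ k ∈ a.toFinset, ((a.count k).factorial : ℝ) := by
    apply Finset.prod_congr rfl
    intro k hk
    have : k ∉ b := fun hb => Finset.disjoint_left.1 h hk (Multiset.mem_toFinset.2 hb)
    rw [Multiset.count_add, Multiset.count_eq_zero_of_notMem this, add_zero]
  have e2 : ∏ k ∈ b.toFinset, (((a + b).count k).factorial : ℝ) =
      ∏ k ∈ b.toFinset, ((b.count k).factorial : ℝ) := by
    apply Finset.prod_congr rfl
    intro k hk
    have : k ∉ a := fun hb => Finset.disjoint_left.1 h (Multiset.mem_toFinset.2 hb) hk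
    rw [Multiset.count_add, Multiset.count_eq_zero_of_notMem this, zero_add]
  rw [e1, e2]
  push_cast
  rw [← mul_inv]
  congr 1
  ring

lemma split_RR {K : Finset ℕ} {r : ℕ → ℕ} {m : Multiset ℕ} (h : ∀ k ∈ K, m.count k = r k) :
    m.filter (· ∉ K) + RR K r = m := by
  ext a
  rw [Multiset.count_add, count_RR, Multiset.count_filter]
  by_cases ha : a ∈ K
  · simp [ha, h a ha]
  · simp [ha]

lemma pp_zero {A : Set ℕ} {K : Finset ℕ} {r : ℕ → ℕ} {n : ℕ} (h : n < ∑ k ∈ K, k * r k) :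
    pp A K r n = 0 := by
  classical
  unfold pp
  rw [Finset.filter_eq_empty_iff.2, Finset.sum_empty]
  rintro m hm ⟨_, h2⟩
  have := (mem_PN.1 hm).1
  rw [← split_RR h2, Multiset.sum_add, sum_RR] at this
  omega

lemma pp_eq {A : Set ℕ} {K : Finset ℕ} (hK : ↑K ⊆ A) (h0 : 0 ∉ K) (r : ℕ → ℕ) (n : ℕ) :
    pp A K r (n + ∑ k ∈ K, k * r k) =
      (∏ k ∈ K, (1 / (k : ℝ)) ^ (r k) / (r k).factorial) * aa (A \ ↑K) n := by
  classical
  obtain ⟨B, hB⟩ : ∃ B : Set ℕ, B = A \ ↑K := ⟨_, rfl⟩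
  have hB' : ∀ i, i ∈ B ↔ i ∈ A ∧ i ∉ K := by intro i; rw [hB]; simp
  rw [← hB]
  unfold pp aa
  rw [← wt_RR, Finset.mul_sum]
  apply Finset.sum_nbij' (fun m => m.filter (· ∉ K)) (fun m => m + RR K r)
  · intro m hm
    rw [Finset.mem_filter, mem_PN] at hm
    obtain ⟨⟨h1, h2⟩, h3, h4⟩ := hm
    rw [Finset.mem_filter, mem_PN]
    refine ⟨⟨?_, ?_⟩, ?_⟩
    · rw [← split_RR h4, Multiset.sum_add, sum_RR] at h1
      omega
    · intro i hi
      exact h2 i (Multiset.mem_filter.1 hi).1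
    · intro i hi
      exact (hB' i).2 ⟨h3 i (Multiset.mem_filter.1 hi).1, by simpa using (Multiset.mem_filter.1 hi).2⟩
  · intro m hm
    rw [Finset.mem_filter, mem_PN] at hm
    obtain ⟨⟨h1, h2⟩, h3⟩ := hm
    rw [Finset.mem_filter, mem_PN]
    refine ⟨⟨?_, ?_⟩, ?_, ?_⟩
    · rw [Multiset.sum_add, sum_RR, h1]
    · intro i hi
      rcases Multiset.mem_add.1 hi with hi | hi
      · exact h2 i hi
      · exact Nat.pos_of_ne_zero (fun h => h0 (h ▸ mem_RR hi))
    · intro i hi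
      rcases Multiset.mem_add.1 hi with hi | hi
      · exact ((hB' i).1 (h3 i hi)).1
      · exact hK (mem_RR hi)
    · intro k hk
      have : k ∉ m := fun h => ((hB' k).1 (h3 k h)).2 hk
      rw [Multiset.count_add, count_RR, if_pos hk, Multiset.count_eq_zero_of_notMem this, zero_add]
  · intro m hm
    rw [Finset.mem_filter, mem_PN] at hm
    exact split_RR hm.2.2
  · intro m hm
    rw [Finset.mem_filter, mem_PN] at hm
    rw [Multiset.filter_add, Multiset.filter_eq_self.2, Multiset.filter_eq_nil.2]
    · simp
    · intro a ha; simpa using mem_RR ha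
    · intro a ha; simpa using ((hB' a).1 (hm.2 a ha)).2
  · intro m hm
    rw [Finset.mem_filter, mem_PN] at hm
    rw [mul_comm, ← wt_add, split_RR hm.2.2]
    rw [Finset.disjoint_left]
    intro a ha hb
    rw [Multiset.mem_toFinset] at ha hb
    exact (Multiset.mem_filter.1 ha).2 (mem_RR hb)

lemma aa_nonneg (A : Set ℕ) (n : ℕ) : 0 ≤ aa A n := by
  unfold aa wt
  positivity

lemma aa_fiber (A : Set ℕ) {k : ℕ} (hk : 0 < k) (n : ℕ) :
    aa A n = ∑ j ∈ Finset.range (n + 1), pp A {k} (fun _ => j) n := by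
  classical
  unfold aa pp
  rw [← Finset.sum_fiberwise_of_maps_to (g := fun m : Multiset ℕ => m.count k)
    (t := Finset.range (n + 1))]
  · apply Finset.sum_congr rfl
    intro j _
    rw [Finset.filter_filter]
    apply Finset.sum_congr _ (fun _ _ => rfl)
    ext m
    simp
  · intro m hm
    rw [Finset.mem_filter, mem_PN] at hm
    rw [Finset.mem_range]
    have h1 : m.count k * k ≤ m.sum := by
      have h := split_RR (K := {k}) (r := fun _ => m.count k) (m := m) (by simp)
      rw [← h, Multiset.sum_add, sum_RR]
      simp only [Finset.sum_singleton]
      rw [h, mul_comm]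
      omega
    rw [hm.1.1] at h1
    nlinarith

/-- Generating function identity in convolution form. -/
lemma aa_conv (A : Set ℕ) {k : ℕ} (hk : 0 < k) (hkA : k ∈ A) (n0 : ℕ) (hn0 : n0 < k) (i : ℕ) :
    aa A (n0 + k * i) = ∑ p ∈ Finset.HasAntidiagonal.antidiagonal i,
      (1 / (k : ℝ)) ^ p.1 / p.1.factorial * aa (A \ {k}) (n0 + k * p.2) := by
  rw [aa_fiber A hk, Finset.Nat.sum_antidiagonal_eq_sum_range_succ_mk,
    ← Finset.sum_subset (s₁ := Finset.range (i + 1))]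
  · apply Finset.sum_congr rfl
    intro j hj
    rw [Finset.mem_range] at hj
    obtain ⟨l, rfl⟩ : ∃ l, i = j + l := ⟨i - j, by omega⟩
    have := pp_eq (A := A) (K := {k}) (by simpa using hkA) (by simpa using hk.ne) (fun _ => j)
      (n0 + k * l)
    simp only [Finset.sum_singleton, Finset.prod_singleton, Finset.coe_singleton] at this
    rw [show n0 + k * (j + l) = n0 + k * l + k * j by ring, this]
    simp
  · intro j hj
    rw [Finset.mem_range] at *
    nlinarith
  · intro j _ hj
    rw [Finset.mem_range] at hj
    apply pp_zero
    simp only [Finset.sum_singleton]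
    have : i + 1 ≤ j := by omega
    nlinarith

lemma aa_inv (A : Set ℕ) {k : ℕ} (hk : 0 < k) (hkA : k ∈ A) (n0 : ℕ) (hn0 : n0 < k) (i : ℕ) :
    aa (A \ {k}) (n0 + k * i) = ∑ p ∈ Finset.HasAntidiagonal.antidiagonal i,
      (-(1 / (k : ℝ))) ^ p.1 / p.1.factorial * aa A (n0 + k * p.2) := by
  let F : PowerSeries ℝ := PowerSeries.mk fun i => aa A (n0 + k * i)
  let G : PowerSeries ℝ := PowerSeries.mk fun i => aa (A \ {k}) (n0 + k * i)
  let E (c : ℝ) : PowerSeries ℝ := PowerSeries.rescale c (PowerSeries.exp ℝ)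
  have hE : ∀ c j, PowerSeries.coeff j (E c) = c ^ j / j.factorial := by
    intro c j
    simp [E, PowerSeries.coeff_rescale, PowerSeries.coeff_exp, div_eq_mul_inv]
  have hF : F = E (1 / k) * G := by
    ext j
    rw [PowerSeries.coeff_mul]
    simp only [hE]
    simp only [F, G, PowerSeries.coeff_mk]
    exact aa_conv A hk hkA n0 hn0 j
  have hG : G = E (-(1 / k)) * F := by
    rw [hF, ← mul_assoc]
    have : E (-(1 / k)) * E (1 / k) = 1 := by
      simp only [E]
      rw [PowerSeries.exp_mul_exp_eq_exp_add]
      simp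
    rw [this, one_mul]
  have := congrArg (PowerSeries.coeff i) hG
  rw [PowerSeries.coeff_mul] at this
  simp only [hE] at this
  simpa only [F, G, PowerSeries.coeff_mk] using this

lemma ana_pos {v : ℕ → ℝ} (hv : ∀ n, 0 ≤ v n)
    (h : Tendsto (fun n => v n / v (n - 1)) atTop (nhds 1)) :
    ∃ M, ∀ n ≥ M, 0 < v n ∧ v n ≤ 2 * v (n + 1) := by
  have h1 : ∀ᶠ n in atTop, (1 / 2 : ℝ) < v n / v (n - 1) :=
    h.eventually_const_lt (by norm_num)
  obtain ⟨M, hM⟩ := eventually_atTop.1 h1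
  refine ⟨M, fun n hn => ?_⟩
  have hp : 0 < v n := by
    apply lt_of_le_of_ne (hv n)
    intro h0
    have := hM n hn
    rw [← h0, zero_div] at this
    norm_num at this
  refine ⟨hp, ?_⟩
  have := hM (n + 1) (by omega)
  rw [Nat.add_sub_cancel, lt_div_iff₀ hp] at this
  linarith

lemma ana_shift {v : ℕ → ℝ} (hv : ∀ n, 0 ≤ v n)
    (h : Tendsto (fun n => v n / v (n - 1)) atTop (nhds 1)) (s : ℕ) :
    Tendsto (fun n => v (n - s) / v n) atTop (nhds 1) := by
  obtain ⟨M, hM⟩ := ana_pos hv h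
  induction s with
  | zero =>
    apply tendsto_const_nhds.congr'
    filter_upwards [eventually_ge_atTop M] with n hn
    simp [(hM n hn).1.ne']
  | succ s ih =>
    have h1 : Tendsto (fun n => (v (n - s) / v (n - s - 1))⁻¹) atTop (nhds 1) := by
      have := (h.comp (tendsto_sub_atTop_nat s)).inv₀ one_ne_zero
      simpa using this
    have h2 := h1.mul ih
    rw [one_mul] at h2
    apply h2.congr'
    filter_upwards [eventually_ge_atTop (M + s + 1)] with n hn
    have := (hM (n - s) (by omega)).1.ne'
    rw [show n - (s + 1) = n - s - 1 by omega]
    field_simp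

lemma ana_bound {v : ℕ → ℝ} (hv : ∀ n, 0 ≤ v n)
    (h : Tendsto (fun n => v n / v (n - 1)) atTop (nhds 1)) :
    ∃ C : ℝ, ∃ M, 0 ≤ C ∧ ∀ n ≥ M, 0 < v n ∧ ∀ s ≤ n, v (n - s) ≤ C * 2 ^ s * v n := by
  obtain ⟨M, hM⟩ := ana_pos hv h
  have hMp := (hM M le_rfl).1
  have claim : ∀ n ≥ M, ∀ s, v n ≤ 2 ^ s * v (n + s) := by
    intro n hn s
    induction s with
    | zero => simp
    | succ s ih =>
      have h2 := (hM (n + s) (by omega)).2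
      calc v n ≤ 2 ^ s * v (n + s) := ih
        _ ≤ 2 ^ s * (2 * v (n + s + 1)) := by gcongr
        _ = _ := by rw [pow_succ, ← add_assoc]; ring
  have hs0 : 0 ≤ ∑ i ∈ Finset.range M, v i := Finset.sum_nonneg (fun i _ => hv i)
  set C := (∑ i ∈ Finset.range M, v i) / v M + 1 with hC
  have hC1 : 1 ≤ C := by
    have := div_nonneg hs0 hMp.le
    linarith
  refine ⟨C, M, by linarith, fun n hn => ⟨(hM n hn).1, fun s hs => ?_⟩⟩
  have hvn := (hM n hn).1
  by_cases hc : M ≤ n - s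
  · have := claim (n - s) hc s
    rw [Nat.sub_add_cancel hs] at this
    calc v (n - s) ≤ 2 ^ s * v n := this
      _ = 1 * (2 ^ s * v n) := by ring
      _ ≤ C * (2 ^ s * v n) := by gcongr
      _ = _ := by ring
  · have h1 : v (n - s) ≤ C * v M := by
      have h3 : v (n - s) ≤ ∑ i ∈ Finset.range M, v i :=
        Finset.single_le_sum (f := v) (fun i _ => hv i) (Finset.mem_range.2 (by omega))
      have : C * v M = (∑ i ∈ Finset.range M, v i) + v M := by
        rw [hC]; field_simp
      linarith
    have h2 := claim M le_rfl (n - M)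
    rw [Nat.add_sub_cancel' hn] at h2
    have h4 : (2 : ℝ) ^ (n - M) ≤ 2 ^ s := pow_le_pow_right₀ (by norm_num) (by omega)
    calc v (n - s) ≤ C * v M := h1
      _ ≤ C * (2 ^ (n - M) * v n) := by gcongr
      _ ≤ C * (2 ^ s * v n) := by gcongr
      _ = _ := by ring

lemma ana_main {v : ℕ → ℝ} (hv : ∀ n, 0 ≤ v n)
    (h : Tendsto (fun n => v n / v (n - 1)) atTop (nhds 1)) (c : ℝ) (d : ℕ) (hd : 0 < d) :
    Tendsto (fun n => (∑ j ∈ Finset.range (n / d + 1),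
      c ^ j / j.factorial * v (n - d * j)) / v n) atTop (nhds (Real.exp c)) := by
  obtain ⟨C, M, hC, hM⟩ := ana_bound hv h
  have hexp : Real.exp c = ∑' j : ℕ, c ^ j / j.factorial := by
    rw [Real.exp_eq_exp_ℝ, NormedSpace.exp_eq_tsum_div]
  rw [hexp]
  let f : ℕ → ℕ → ℝ := fun n j =>
    if j < n / d + 1 then c ^ j / j.factorial * (v (n - d * j) / v n) else 0
  have hf : ∀ n, (∑ j ∈ Finset.range (n / d + 1),
      c ^ j / j.factorial * v (n - d * j)) / v n = ∑' j, f n j := by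
    intro n
    rw [tsum_eq_sum (s := Finset.range (n / d + 1)), Finset.sum_div]
    · apply Finset.sum_congr rfl
      intro j hj
      simp only [f]
      rw [if_pos (Finset.mem_range.1 hj)]
      ring
    · intro j hj
      simp only [f]
      rw [if_neg (by simpa using hj)]
  simp_rw [hf]
  apply tendsto_tsum_of_dominated_convergence
    (bound := fun j : ℕ => C * ((|c| * 2 ^ d) ^ j / j.factorial))
  · exact (Real.summable_pow_div_factorial _).mul_left C
  · intro j
    have h1 := (ana_shift hv h (d * j)).const_mul (c ^ j / (j.factorial : ℝ))
    rw [mul_one] at h1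
    apply h1.congr'
    filter_upwards [eventually_ge_atTop (d * j)] with n hn
    simp only [f]
    rw [if_pos]
    have : j ≤ n / d := by rw [Nat.le_div_iff_mul_le hd, mul_comm]; exact hn
    omega
  · filter_upwards [eventually_ge_atTop M] with n hn j
    simp only [f]
    split_ifs with hj
    · have hj' : d * j ≤ n := by
        have : j ≤ n / d := by omega
        rw [Nat.le_div_iff_mul_le hd, mul_comm] at this
        exact this
      obtain ⟨hp, hb⟩ := hM n hn
      have h3 : v (n - d * j) / v n ≤ C * 2 ^ (d * j) := by
        rw [div_le_iff₀ hp]; exact hb _ hj'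
      rw [norm_mul, norm_div, norm_pow, Real.norm_eq_abs, Real.norm_eq_abs, Real.norm_eq_abs,
        abs_of_nonneg (div_nonneg (hv _) (hv _)), Nat.abs_cast]
      calc |c| ^ j / j.factorial * (v (n - d * j) / v n)
          ≤ |c| ^ j / j.factorial * (C * 2 ^ (d * j)) := by gcongr
        _ = _ := by rw [mul_pow, pow_mul]; ring
    · rw [norm_zero]; positivity

lemma aa_step (A : Set ℕ) (q : ℕ) (hq : 0 < q) {k : ℕ} (hk : 0 < k) (hkA : k ∈ A) (hqk : q ∣ k)
    (h : Tendsto (fun n => aa A (q * n) / aa A (q * (n - 1))) atTop (nhds 1)) :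
    Tendsto (fun n => aa (A \ {k}) (q * n) / aa A (q * n)) atTop
      (nhds (Real.exp (-(1 / (k : ℝ))))) := by
  obtain ⟨d, rfl⟩ := hqk
  have hd : 0 < d := Nat.pos_of_mul_pos_left hk
  have := ana_main (v := fun n => aa A (q * n)) (fun n => aa_nonneg _ _) h
    (-(1 / ((q * d : ℕ) : ℝ))) d hd
  apply this.congr
  intro n
  congr 1
  have hn := Nat.mod_add_div n d
  have e := aa_inv A hk hkA (q * (n % d)) (by
    have := Nat.mod_lt n hd
    exact (Nat.mul_lt_mul_left hq).2 this) (n / d)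
  rw [Finset.Nat.sum_antidiagonal_eq_sum_range_succ_mk] at e
  rw [show q * n = q * (n % d) + q * d * (n / d) by rw [mul_assoc, ← mul_add, hn], e]
  apply Finset.sum_congr rfl
  intro j hj
  rw [Finset.mem_range] at hj
  congr 2
  obtain ⟨l, hl⟩ : ∃ l, n / d = j + l := ⟨n / d - j, by omega⟩
  rw [hl] at hn ⊢
  rw [Nat.add_sub_cancel_left, mul_assoc, ← mul_add]
  congr 1
  rw [mul_add] at hn
  change n - d * j = n % d + d * l
  omega

lemma aa_ind (A : Set ℕ) (q : ℕ) (hq : 0 < q)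
    (h : Tendsto (fun n => aa A (q * n) / aa A (q * (n - 1))) atTop (nhds 1))
    (K : Finset ℕ) : (∀ k ∈ K, 0 < k ∧ k ∈ A ∧ q ∣ k) →
    Tendsto (fun n => aa (A \ ↑K) (q * n) / aa (A \ ↑K) (q * (n - 1))) atTop (nhds 1) ∧
    Tendsto (fun n => aa (A \ ↑K) (q * n) / aa A (q * n)) atTop
      (nhds (∏ k ∈ K, Real.exp (-(1 / (k : ℝ))))) := by
  classical
  induction K using Finset.induction_on with
  | empty =>
    intro _
    simp only [Finset.coe_empty, Set.sdiff_empty, Finset.prod_empty]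
    refine ⟨h, ?_⟩
    exact (ana_shift (v := fun n => aa A (q * n)) (fun n => aa_nonneg _ _) h 0)
  | insert a K ha ih =>
    intro hK
    obtain ⟨h1, h2⟩ := ih (fun k hk => hK k (Finset.mem_insert_of_mem hk))
    obtain ⟨ha0, haA, hqa⟩ := hK a (Finset.mem_insert_self _ _)
    have h3 := aa_step (A \ ↑K) q hq ha0 ⟨haA, by simpa using ha⟩ hqa h1
    have eset : (A \ ↑K) \ {a} = A \ ↑(insert a K) := by
      ext x; simp; tauto
    rw [eset] at h3
    obtain ⟨M, hM⟩ := ana_pos (v := fun n => aa (A \ ↑K) (q * n)) (fun n => aa_nonneg _ _) h1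
    constructor
    · have h4 : Tendsto (fun n : ℕ => (n - 1)) atTop atTop := tendsto_sub_atTop_nat 1
      have h5 := (h3.mul h1).mul ((h3.comp h4).inv₀ (Real.exp_pos _).ne')
      rw [mul_one, mul_inv_cancel₀ (Real.exp_pos _).ne'] at h5
      apply h5.congr'
      filter_upwards [eventually_ge_atTop (M + 1)] with n hn
      have e1 := (hM n (by omega)).1.ne'
      have e2 := (hM (n - 1) (by omega)).1.ne'
      simp only [Function.comp]
      field_simp
    · rw [Finset.prod_insert ha]
      apply (h3.mul h2).congr'
      filter_upwards [eventually_ge_atTop M] with n hn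
      have e1 := (hM n (by omega)).1.ne'
      field_simp

lemma permCount_eq_s14 (A : Set ℕ) (n : ℕ) : (permCount A n : ℝ) = n.factorial * aa A n := by
  classical
  unfold permCount aa
  rw [← card_pred]
  simp_rw [minPer_mem]

lemma card_pp (A : Set ℕ) (K : Finset ℕ) (r : ℕ → ℕ) (n : ℕ) :
    (Nat.card {s : Equiv.Perm (Fin n) //
          (∀ x, Function.minimalPeriod ⇑s x ∈ A) ∧ ∀ k ∈ K, cycleCount s k = r k} : ℝ) =
      n.factorial * pp A K r n := by
  classical
  unfold pp
  rw [← card_pred (fun m => (∀ k ∈ m, k ∈ A) ∧ ∀ k ∈ K, m.count k = r k)]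
  simp_rw [minPer_mem, cycleCount_eq]

lemma main_pos (A : Set ℕ) (q : ℕ) (hq : 0 < q)
    (h : Tendsto (fun n => aa A (q * n) / aa A (q * (n - 1))) atTop (nhds 1))
    (K : Finset ℕ) (r : ℕ → ℕ) (hK : ∀ k ∈ K, 0 < k ∧ k ∈ A ∧ q ∣ k) :
    Tendsto (fun n => pp A K r (q * n) / aa A (q * n)) atTop
      (nhds (∏ k ∈ K, Real.exp (-(1 / (k : ℝ))) * (1 / (k : ℝ)) ^ (r k) / (r k).factorial)) := by
  obtain ⟨h1, h2⟩ := aa_ind A q hq h K hK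
  obtain ⟨s, hs⟩ : q ∣ ∑ k ∈ K, k * r k :=
    Finset.dvd_sum (fun k hk => Dvd.dvd.mul_right (hK k hk).2.2 _)
  have h3 := ana_shift (v := fun n => aa (A \ ↑K) (q * n)) (fun n => aa_nonneg _ _) h1 s
  obtain ⟨M, hM⟩ := ana_pos (v := fun n => aa (A \ ↑K) (q * n)) (fun n => aa_nonneg _ _) h1
  have h4 := (h2.mul h3).mul_const (∏ k ∈ K, (1 / (k : ℝ)) ^ (r k) / (r k).factorial)
  rw [mul_one, ← Finset.prod_mul_distrib] at h4
  simp_rw [mul_div_assoc]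
  apply h4.congr'
  filter_upwards [eventually_ge_atTop (M + s)] with n hn
  have e1 := (hM n (by omega)).1.ne'
  have e := pp_eq (A := A) (K := K) (fun k hk => (hK k hk).2.1)
    (fun h0 => absurd (hK 0 h0).1 (by omega)) r (q * (n - s))
  rw [hs, ← mul_add, Nat.sub_add_cancel (by omega)] at e
  rw [e]
  field_simp

lemma ct_zero_notMem {n : ℕ} {m : Multiset ℕ} (hm : m ∈ PN n) : m.count 0 = 0 :=
  Multiset.count_eq_zero_of_notMem (fun h => by have := (mem_PN.1 hm).2 0 h; omega)

end

theorem stmt_14 (A : Set ℕ) (q : ℕ) (hq : 0 < q)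
    (hgcd : (∀ a ∈ A, q ∣ a) ∧ ∀ d : ℕ, (∀ a ∈ A, d ∣ a) → d ∣ q)
    (hu : Tendsto (fun n : ℕ =>
        ((permCount A (q * n) : ℝ) / (q * n).factorial) /
          ((permCount A (q * (n - 1)) : ℝ) / (q * (n - 1)).factorial))
      atTop (nhds 1))
    (K : Finset ℕ) (hK : ↑K ⊆ A) (r : ℕ → ℕ) :
    Tendsto (fun n : ℕ =>
      (Nat.card {s : Equiv.Perm (Fin (q * n)) //
          (∀ x, Function.minimalPeriod ⇑s x ∈ A) ∧ ∀ k ∈ K, cycleCount s k = r k} : ℝ) /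
        (permCount A (q * n) : ℝ))
      atTop
      (nhds (∏ k ∈ K, Real.exp (-(1 / (k : ℝ))) * (1 / (k : ℝ)) ^ (r k) / (r k).factorial)) := by
  classical
  have hfac : ∀ n : ℕ, (n.factorial : ℝ) ≠ 0 := fun n => by exact_mod_cast n.factorial_ne_zero
  simp_rw [permCount_eq_s14, mul_div_cancel_left₀ _ (hfac _)] at hu
  simp_rw [permCount_eq_s14, card_pp, mul_div_mul_left _ _ (hfac _)]
  have hmain := main_pos A q hq hu (K.erase 0) r (fun k hk => by
    rw [Finset.mem_erase] at hk
    exact ⟨Nat.pos_of_ne_zero hk.1, hK hk.2, hgcd.1 k (hK hk.2)⟩)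
  by_cases h0 : 0 ∈ K
  · rw [← Finset.mul_prod_erase K _ h0]
    by_cases hr : r 0 = 0
    · have e : ∀ n, pp A K r n = pp A (K.erase 0) r n := by
        intro n
        unfold pp
        apply Finset.sum_congr _ (fun _ _ => rfl)
        apply Finset.filter_congr
        intro m hm
        apply and_congr_right
        intro _
        constructor
        · exact fun h k hk => h k (Finset.mem_of_mem_erase hk)
        · intro h k hk
          by_cases hk0 : k = 0
          · subst hk0; rw [ct_zero_notMem hm, hr]
          · exact h k (Finset.mem_erase.2 ⟨hk0, hk⟩)
      simp_rw [e]
      simpa [hr] using hmain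
    · have e : ∀ n, pp A K r n = 0 := by
        intro n
        unfold pp
        rw [Finset.filter_eq_empty_iff.2, Finset.sum_empty]
        rintro m hm ⟨_, h2⟩
        have := h2 0 h0
        rw [ct_zero_notMem hm] at this
        exact hr this.symm
      simp_rw [e]
      simp [hr]
  · rwa [Finset.erase_eq_of_notMem h0] at hmain
end
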